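/- Let k ≥ 2 and let F be a minimally unsatisfiable 2-clause-set of deficiency k. Then the implication digraph idg(F) is a 2k-weak-double-cycle. -/

import Mathlib

/-- A literal: a variable (a natural number) together with a polarity. -/
abbrev Lit : Type := ℕ × Bool

/-- Complementation of literals: a fixed-point-free involution. -/
def Lit.compl (x : Lit) : Lit := (x.1, !x.2)

/-- The set of variables occurring in a clause-set. -/
def varsOf (F : Finset (Finset Lit)) : Finset ℕ := F.biUnion (fun C => C.image Prod.fst)

/-- The literals over the variables of `F` (both polarities). -/
def litsOf (F : Finset (Finset Lit)) : Finset Lit := varsOf F ×ˢ (Finset.univ : Finset Bool)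

/-- A clause is clash-free. -/
def IsClause (C : Finset Lit) : Prop := ∀ x ∈ C, Lit.compl x ∉ C

/-- A clause-set consists of clauses. -/
def IsClauseSet (F : Finset (Finset Lit)) : Prop := ∀ C ∈ F, IsClause C

/-- The truth value of a literal under a total assignment. -/
def LitVal (φ : ℕ → Bool) (x : Lit) : Bool := if x.2 then φ x.1 else !(φ x.1)

/-- Satisfiability of a clause-set. -/
def Sat (F : Finset (Finset Lit)) : Prop := ∃ φ : ℕ → Bool, ∀ C ∈ F, ∃ x ∈ C, LitVal φ x = true

/-- Minimal unsatisfiability. -/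
def MU (F : Finset (Finset Lit)) : Prop := IsClauseSet F ∧ ¬ Sat F ∧ ∀ G ⊂ F, Sat G

/-- Minimally unsatisfiable 2-clause-set. -/
def MU2 (F : Finset (Finset Lit)) : Prop := MU F ∧ ∀ C ∈ F, C.card ≤ 2

/-- The deficiency δ(F) = c(F) - n(F). -/
def deficiency (F : Finset (Finset Lit)) : ℤ := (F.card : ℤ) - ((varsOf F).card : ℤ)

/-- Literal-degree: number of clauses containing the literal. -/
def ldeg (F : Finset (Finset Lit)) (x : Lit) : ℕ := (F.filter (fun C => x ∈ C)).card

/-- Variable-degree. -/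
def vdeg (F : Finset (Finset Lit)) (v : ℕ) : ℕ := ldeg F (v, true) + ldeg F (v, false)

/-- Isomorphism of clause-sets: a bijection between the literals over the variables,
commuting with complementation, mapping one clause-set onto the other. -/
def CNFIso (F F' : Finset (Finset Lit)) (f : Lit → Lit) : Prop :=
  Set.BijOn f ↑(litsOf F) ↑(litsOf F') ∧
  (∀ x ∈ litsOf F, f (Lit.compl x) = Lit.compl (f x)) ∧
  F.image (fun C => C.image f) = F'

/-- A digraph: a finite vertex set and a finite set of arcs. -/
structure FinDigraph (α : Type) where
  V : Finset α
  E : Finset (α × α)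

/-- Well-formedness of a digraph: arcs join distinct vertices. -/
def FinDigraph.WellFormed {α : Type} (G : FinDigraph α) : Prop :=
  ∀ p ∈ G.E, p.1 ∈ G.V ∧ p.2 ∈ G.V ∧ p.1 ≠ p.2

/-- `f` is an isomorphism of digraphs from `G` to `G'`. -/
def DigraphIso {α β : Type} [DecidableEq β] (G : FinDigraph α) (G' : FinDigraph β) (f : α → β) : Prop :=
  Set.BijOn f ↑G.V ↑G'.V ∧ G.E.image (fun p => (f p.1, f p.2)) = G'.E

/-- The implication digraph of a 2-clause-set (without the empty clause):
vertices are the literals over the variables of `F`, and there is an arc `(a,b)` iff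
`{compl a} ∪ {b}` is a clause of `F` (this yields `(x̄,y),(ȳ,x)` for a clause `{x,y}`
and `(x̄,x)` for a unit-clause `{x}`). -/
def idg (F : Finset (Finset Lit)) : FinDigraph Lit :=
  ⟨litsOf F, (litsOf F ×ˢ litsOf F).filter (fun p => insert (Lit.compl p.1) {p.2} ∈ F)⟩

def FinDigraph.inDeg {α : Type} [DecidableEq α] (G : FinDigraph α) (v : α) : ℕ :=
  (G.E.filter (fun p => p.2 = v)).card

def FinDigraph.outDeg {α : Type} [DecidableEq α] (G : FinDigraph α) (v : α) : ℕ :=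
  (G.E.filter (fun p => p.1 = v)).card

/-- The standard double `m`-cycle. -/
def stdDoubleCycle (m : ℕ) : FinDigraph ℕ :=
  ⟨Finset.range m, (Finset.range m).biUnion (fun i => {(i, (i+1) % m), ((i+1) % m, i)})⟩

/-- A double `m`-cycle (`m ≥ 3`). -/
def IsDoubleCycle {α : Type} [DecidableEq α] (m : ℕ) (G : FinDigraph α) : Prop :=
  3 ≤ m ∧ ∃ f : ℕ → α, DigraphIso (stdDoubleCycle m) G f

/-- Splitting a vertex `x` into `u`, `v` with a new arc `(u,v)`:
arcs into `x` now go into `u`, arcs out of `x` now leave `v`. -/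
def SplitVertex {α : Type} [DecidableEq α] (G G' : FinDigraph α) : Prop :=
  ∃ x u v, x ∈ G.V ∧ u ∉ G.V ∧ v ∉ G.V ∧ u ≠ v ∧
    G'.V = insert u (insert v (G.V.erase x)) ∧
    G'.E = insert (u, v)
      ((G.E.filter (fun p => p.1 ≠ x ∧ p.2 ≠ x)) ∪
       ((G.E.filter (fun p => p.2 = x)).image (fun p => (p.1, u))) ∪
       ((G.E.filter (fun p => p.1 = x)).image (fun p => (v, p.2))))

/-- Splitting an arc `(x,y)` by a new (linear) vertex `v`. -/
def SplitArc {α : Type} [DecidableEq α] (G G' : FinDigraph α) : Prop :=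
  ∃ x y v, (x, y) ∈ G.E ∧ v ∉ G.V ∧
    G'.V = insert v G.V ∧
    G'.E = insert (x, v) (insert (v, y) (G.E.erase (x, y)))

/-- An `m`-weak-double-cycle: obtained from a double `m`-cycle by a finite sequence
of vertex splittings and arc splittings. -/
def IsWDC {α : Type} [DecidableEq α] (m : ℕ) (G : FinDigraph α) : Prop :=
  ∃ G₀ : FinDigraph α, IsDoubleCycle m G₀ ∧
    Relation.ReflTransGen (fun A B => SplitVertex A B ∨ SplitArc A B) G₀ G

/-- A digraph is nonlinear if no vertex has in-degree 1 and out-degree 1. -/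
def FinDigraph.Nonlinear {α : Type} [DecidableEq α] (G : FinDigraph α) : Prop :=
  ∀ v ∈ G.V, ¬ (G.inDeg v = 1 ∧ G.outDeg v = 1)

/-- Strong connectivity. -/
def StronglyConnected {α : Type} (G : FinDigraph α) : Prop :=
  ∀ a ∈ G.V, ∀ b ∈ G.V, Relation.ReflTransGen (fun x y => (x, y) ∈ G.E) a b

/-- A cycle digraph: strongly connected, at least 2 vertices, all vertices linear. -/
def IsCycleDigraph {α : Type} [DecidableEq α] (G : FinDigraph α) : Prop :=
  G.WellFormed ∧ 2 ≤ G.V.card ∧ StronglyConnected G ∧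
    ∀ v ∈ G.V, G.inDeg v = 1 ∧ G.outDeg v = 1

/-- A skew-symmetry of a digraph, as a permutation of its vertex set:
a fixed-point-free involution reversing arcs. -/
def IsSkewSym {α : Type} (G : FinDigraph α) (σ : Equiv.Perm {x // x ∈ G.V}) : Prop :=
  (∀ v, σ (σ v) = v) ∧ (∀ v, σ v ≠ v) ∧
  ∀ a b : {x // x ∈ G.V}, ((a : α), (b : α)) ∈ G.E → (((σ b : α)), ((σ a : α))) ∈ G.E

/-- A skew-symmetry has a unit if some vertex is joined by an arc to its image. -/
def HasUnit {α : Type} (G : FinDigraph α) (σ : Equiv.Perm {x // x ∈ G.V}) : Prop :=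
  ∃ v : {x // x ∈ G.V}, ((v : α), ((σ v : α))) ∈ G.E

/-- The literals over the variables of `F` are closed under complementation. -/
lemma compl_mem {F : Finset (Finset Lit)} {x : Lit} (h : x ∈ litsOf F) :
    Lit.compl x ∈ litsOf F := by
  simp only [litsOf, Lit.compl, Finset.mem_product] at h ⊢
  exact ⟨h.1, Finset.mem_univ _⟩

/-- Clause-set isomorphism, as an equivalence between the literals over the variables. -/
def CNFIsoE (F F' : Finset (Finset Lit))
    (e : {x // x ∈ litsOf F} ≃ {x // x ∈ litsOf F'}) : Prop :=
  (∀ x : {x // x ∈ litsOf F}, (e ⟨Lit.compl x.1, compl_mem x.2⟩ : Lit) = Lit.compl (e x : Lit)) ∧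
  F.image (fun C => C.image (fun y =>
      if h : y ∈ litsOf F then ((e ⟨y, h⟩ : {x // x ∈ litsOf F'}) : Lit) else y)) = F'

/-- An automorphism of a digraph, as a permutation of its vertex set preserving arcs. -/
def FinDigraphAut {α : Type} (G : FinDigraph α) (π : Equiv.Perm {x // x ∈ G.V}) : Prop :=
  ∀ a b : {x // x ∈ G.V}, ((a : α), (b : α)) ∈ G.E ↔ ((π a : α), (π b : α)) ∈ G.E

/-- Multiplicity of the edge between `u` and `v` in the underlying multigraph of a digraph. -/
def mult {α : Type} [DecidableEq α] (G : FinDigraph α) (u v : α) : ℕ :=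
  (if (u, v) ∈ G.E then 1 else 0) + (if (v, u) ∈ G.E then 1 else 0)

/-- `f` is an isomorphism between the underlying multigraphs of two digraphs. -/
def MultigraphIso {α β : Type} [DecidableEq α] [DecidableEq β]
    (G : FinDigraph α) (G' : FinDigraph β) (f : α → β) : Prop :=
  Set.BijOn f ↑G.V ↑G'.V ∧ ∀ u ∈ G.V, ∀ v ∈ G.V, mult G u v = mult G' (f u) (f v)

/-- `f` is an isomorphism between the underlying graphs of two digraphs. -/
def GraphIso {α β : Type} (G : FinDigraph α) (G' : FinDigraph β) (f : α → β) : Prop :=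
  Set.BijOn f ↑G.V ↑G'.V ∧ ∀ u ∈ G.V, ∀ v ∈ G.V,
    (((u, v) ∈ G.E ∨ (v, u) ∈ G.E) ↔ ((f u, f v) ∈ G'.E ∨ (f v, f u) ∈ G'.E))

/-- The transpose of a digraph: all arcs reversed. -/
def FinDigraph.transpose {α : Type} [DecidableEq α] (G : FinDigraph α) : FinDigraph α :=
  ⟨G.V, G.E.image (fun p => (p.2, p.1))⟩

/-- DP-reduction on variable `v`: replace all clauses containing `v` or `v̄` by all
their non-tautological resolvents on `v`. -/
def DP (v : ℕ) (F : Finset (Finset Lit)) : Finset (Finset Lit) :=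
  (F.filter (fun C => (v, true) ∉ C ∧ (v, false) ∉ C)) ∪
  ((((F.filter (fun C => (v, true) ∈ C)) ×ˢ (F.filter (fun C => (v, false) ∈ C))).image
      (fun p => (p.1.erase (v, true)) ∪ (p.2.erase (v, false)))).filter
    (fun C => ∀ x ∈ C, Lit.compl x ∉ C))

/-- A variable is singular if one of its literals has literal-degree 1. -/
def Singular (F : Finset (Finset Lit)) (v : ℕ) : Prop :=
  ldeg F (v, true) = 1 ∨ ldeg F (v, false) = 1

/-- The "middle part" `M_n = {{v̄_1,v_2},…,{v̄_{n−1},v_n}}`, with variables `1,…,n`. -/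
def Mn (n : ℕ) : Finset (Finset Lit) :=
  (Finset.Icc 1 (n - 1)).image (fun i => ({(i, false), (i + 1, true)} : Finset Lit))

def famU2 (n : ℕ) : Finset (Finset Lit) :=
  Mn n ∪ {({((1 : ℕ), true)} : Finset Lit), ({((n : ℕ), false)} : Finset Lit)}

def famU1 (n i : ℕ) : Finset (Finset Lit) :=
  Mn n ∪ {({((1 : ℕ), true)} : Finset Lit), ({((n : ℕ), false), ((i : ℕ), false)} : Finset Lit)}

def famU0s (n i : ℕ) : Finset (Finset Lit) :=
  Mn n ∪ {({((1 : ℕ), true), ((i : ℕ), true)} : Finset Lit),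
          ({((n : ℕ), false), ((i : ℕ), false)} : Finset Lit)}

def famU0 (n x y : ℕ) : Finset (Finset Lit) :=
  Mn n ∪ {({((1 : ℕ), true), ((x : ℕ), true)} : Finset Lit),
          ({((n : ℕ), false), ((y : ℕ), false)} : Finset Lit)}

/-- Membership in one of the four families (with the stated parameter ranges). -/
def InFam (G : Finset (Finset Lit)) : Prop :=
  (∃ n, 1 ≤ n ∧ G = famU2 n) ∨
  (∃ n i, 2 ≤ n ∧ 1 ≤ i ∧ i ≤ n - 1 ∧ G = famU1 n i) ∨
  (∃ n i, 3 ≤ n ∧ 2 ≤ i ∧ 2 * i ≤ n + 1 ∧ G = famU0s n i) ∨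
  (∃ n x y, 4 ≤ n ∧ 2 ≤ x ∧ x < y ∧ y ≤ n - 1 ∧ x + y ≤ n + 1 ∧ G = famU0 n x y)

/-- The number of unit-clauses of `F`. -/
def unitCount (F : Finset (Finset Lit)) : ℕ := (F.filter (fun C => C.card = 1)).card

/-- MU 2-clause-sets of deficiency `k` with exactly `n` variables. -/
def MU2dn (k : ℤ) (n : ℕ) : Type :=
  {F : Finset (Finset Lit) // MU2 F ∧ deficiency F = k ∧ (varsOf F).card = n}

/-- Isomorphism relation on `MU2dn k n`. -/
def isoRel {k : ℤ} {n : ℕ} (F F' : MU2dn k n) : Prop := ∃ f, CNFIso F.1 F'.1 f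

/-- The number of isomorphism classes of MU 2-clause-sets of deficiency `k`
with exactly `n` variables. -/
noncomputable def numClasses (k : ℤ) (n : ℕ) : ℕ := Nat.card (Quot (@isoRel k n))

/-- Equivalence of binary bracelets of length `m`: rotations and reflections of the
cyclic index set. -/
def BraceletRel (m : ℕ) (b b' : ZMod m → Bool) : Prop :=
  ∃ (r : ZMod m) (s : Bool), ∀ i, b' i = b (if s then r - i else i + r)

/-- Digraph-isomorphism relation on nonlinear `m`-WDCs. -/
def NonlinWDCRel (m : ℕ) (G G' : {G : FinDigraph ℕ // IsWDC m G ∧ G.Nonlinear}) : Prop :=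
  ∃ f : ℕ → ℕ, DigraphIso G.1 G'.1 f

/-- `H` is a subdigraph of `G`. -/
def Subdigraph {α : Type} (H G : FinDigraph α) : Prop := H.V ⊆ G.V ∧ H.E ⊆ G.E

namespace Lit

@[simp] lemma compl_invol (x : Lit) : Lit.compl (Lit.compl x) = x := by
  simp [Lit.compl]

lemma compl_ne (x : Lit) : Lit.compl x ≠ x := by
  rcases x with ⟨n, b⟩
  cases b <;> simp [Lit.compl]

@[simp] lemma compl_fst (x : Lit) : (Lit.compl x).1 = x.1 := rfl

lemma compl_inj {x y : Lit} : Lit.compl x = Lit.compl y ↔ x = y := by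
  constructor
  · intro h
    rw [← compl_invol x, h, compl_invol]
  · rintro rfl
    rfl

lemma compl_eq_iff {x y : Lit} : Lit.compl x = y ↔ x = Lit.compl y := by
  rw [← compl_inj, compl_invol]

lemma eq_or_eq_compl {x y : Lit} (h : x.1 = y.1) : x = y ∨ x = Lit.compl y := by
  rcases x with ⟨n, b⟩
  rcases y with ⟨m, c⟩
  simp only at h
  subst h
  cases b <;> cases c <;> simp [Lit.compl]

/-- The clause expressing the implication from `a` to `b`. -/
def imp (a b : Lit) : Finset Lit := insert (Lit.compl a) {b}

lemma mem_imp {a b l : Lit} : l ∈ imp a b ↔ l = Lit.compl a ∨ l = b := by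
  simp [imp]

lemma imp_compl (a b : Lit) : imp (Lit.compl b) (Lit.compl a) = imp a b := by
  ext l
  simp only [mem_imp, compl_invol]
  tauto

lemma pair_eq_pair {a b c d : Lit} :
    ({a, b} : Finset Lit) = {c, d} ↔ (a = c ∧ b = d) ∨ (a = d ∧ b = c) := by
  rw [← Finset.coe_inj]
  push_cast
  exact Set.pair_eq_pair_iff

lemma imp_eq_pair {a b c d : Lit} :
    imp a b = {c, d} ↔ (a = Lit.compl c ∧ b = d) ∨ (a = Lit.compl d ∧ b = c) := by
  rw [imp, pair_eq_pair, compl_eq_iff, compl_eq_iff]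

end Lit

open Lit

lemma litVal_compl (φ : ℕ → Bool) (x : Lit) :
    LitVal φ (Lit.compl x) = true ↔ ¬ LitVal φ x = true := by
  rcases x with ⟨n, b⟩
  cases b <;> simp [LitVal, Lit.compl]

lemma exists_assign (φ : ℕ → Bool) (v : Lit) :
    ∃ ψ : ℕ → Bool, LitVal ψ v = true ∧ ∀ l : Lit, l.1 ≠ v.1 → LitVal ψ l = LitVal φ l := by
  refine ⟨Function.update φ v.1 v.2, ?_, ?_⟩
  · rcases v with ⟨n, b⟩
    cases b <;> simp [LitVal]
  · intro l hl
    simp [LitVal, Function.update_of_ne hl]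

lemma mem_litsOf {F : Finset (Finset Lit)} {x : Lit} :
    x ∈ litsOf F ↔ ∃ C ∈ F, ∃ l ∈ C, l.1 = x.1 := by
  simp only [litsOf, varsOf, Finset.mem_product, Finset.mem_biUnion, Finset.mem_image,
    Finset.mem_univ, and_true]

lemma mem_varsOf {F : Finset (Finset Lit)} {v : ℕ} :
    v ∈ varsOf F ↔ ∃ C ∈ F, ∃ l ∈ C, l.1 = v := by
  simp only [varsOf, Finset.mem_biUnion, Finset.mem_image]

lemma exists_eq_pair {C : Finset Lit} (hC : C.card ≤ 2) {l : Lit} (hl : l ∈ C) :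
    ∃ b ∈ C, C = {l, b} := by
  have h1 : 0 < C.card := Finset.card_pos.2 ⟨l, hl⟩
  obtain h | h : C.card = 1 ∨ C.card = 2 := by omega
  · obtain ⟨c, rfl⟩ := Finset.card_eq_one.1 h
    simp only [Finset.mem_singleton] at hl
    subst hl
    exact ⟨l, by simp, by simp⟩
  · obtain ⟨c, d, -, rfl⟩ := Finset.card_eq_two.1 h
    simp only [Finset.mem_insert, Finset.mem_singleton] at hl
    rcases hl with rfl | rfl
    · exact ⟨d, by simp, rfl⟩
    · exact ⟨c, by simp, Finset.pair_comm _ _⟩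

/-- The assignment `φ` satisfies every clause of `F`. -/
def Models (φ : ℕ → Bool) (F : Finset (Finset Lit)) : Prop :=
  ∀ C ∈ F, ∃ x ∈ C, LitVal φ x = true

lemma Models.mono {φ : ℕ → Bool} {F G : Finset (Finset Lit)} (h : Models φ F) (hG : G ⊆ F) :
    Models φ G := fun C hC => h C (hG hC)

lemma Models.imp {φ : ℕ → Bool} {F : Finset (Finset Lit)} (h : Models φ F) {a b : Lit}
    (hab : imp a b ∈ F) (ha : LitVal φ a = true) : LitVal φ b = true := by
  obtain ⟨l, hl, hv⟩ := h _ hab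
  rcases mem_imp.1 hl with rfl | rfl
  · exact absurd ha ((litVal_compl _ _).1 hv)
  · exact hv

lemma Models.chain {φ : ℕ → Bool} {F : Finset (Finset Lit)} (h : Models φ F) {p : ℕ → Lit}
    {a b : ℕ} (hab : a ≤ b) (hp : ∀ i, a ≤ i → i < b → Lit.imp (p i) (p (i + 1)) ∈ F)
    (ha : LitVal φ (p a) = true) : LitVal φ (p b) = true := by
  induction b, hab using Nat.le_induction with
  | base => exact ha
  | succ n hn ih =>
    exact h.imp (hp n hn (by omega)) (ih fun i hi hi' => hp i hi (by omega))

lemma MU.eq_of_subset {F G : Finset (Finset Lit)} (hF : MU F) (hG : G ⊆ F)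
    (h : ∀ φ, ¬ Models φ G) : G = F := by
  by_contra hne
  obtain ⟨φ, hφ⟩ := hF.2.2 G (Finset.ssubset_iff_subset_ne.2 ⟨hG, hne⟩)
  exact h φ hφ

lemma MU.exists_models_erase {F : Finset (Finset Lit)} (hF : MU F) {C : Finset Lit}
    (hC : C ∈ F) : ∃ φ, Models φ (F.erase C) ∧ ∀ x ∈ C, ¬ LitVal φ x = true := by
  obtain ⟨φ, hφ⟩ := hF.2.2 _ (Finset.erase_ssubset hC)
  refine ⟨φ, hφ, fun x hx hv => hF.2.1 ⟨φ, fun D hD => ?_⟩⟩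
  by_cases h : D = C
  · exact ⟨x, h ▸ hx, hv⟩
  · exact hφ D (Finset.mem_erase.2 ⟨h, hD⟩)

lemma MU.not_models {F : Finset (Finset Lit)} (hF : MU F) (φ : ℕ → Bool) : ¬ Models φ F :=
  fun h => hF.2.1 ⟨φ, h⟩

lemma MU.empty_notMem {F : Finset (Finset Lit)} (hF : MU F) (hd : 2 ≤ deficiency F) :
    ∅ ∉ F := by
  intro h
  have := hF.eq_of_subset (G := {∅}) (by simpa using h) (by
    intro φ hφ
    obtain ⟨x, hx, -⟩ := hφ ∅ (by simp)
    simp at hx)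
  subst this
  simp [deficiency, varsOf] at hd

/-- In a minimally unsatisfiable 2-clause-set every literal implies its complement. -/
lemma MU2.reaches_compl {F : Finset (Finset Lit)} (hF : MU2 F) {x : Lit} (hx : x ∈ litsOf F) :
    Relation.ReflTransGen (fun a b => Lit.imp a b ∈ F) x (Lit.compl x) := by
  classical
  by_contra hcon
  set S : Set Lit := {y | Relation.ReflTransGen (fun a b => Lit.imp a b ∈ F) x y} with hS
  have hswap : ∀ {a b : Lit}, Relation.ReflTransGen (fun a b => Lit.imp a b ∈ F) a b →
      Relation.ReflTransGen (fun a b => Lit.imp a b ∈ F) (Lit.compl b) (Lit.compl a) := by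
    intro a b h
    induction h with
    | refl => exact .refl
    | tail _ h ih => exact .head (by rwa [imp_compl]) ih
  have hcons : ∀ y ∈ S, Lit.compl y ∉ S := by
    intro y hy hy'
    have := hswap hy'
    rw [compl_invol] at this
    exact hcon (Relation.ReflTransGen.trans hy this)
  have hxS : x ∈ S := Relation.ReflTransGen.refl
  obtain ⟨C₀, hC₀, l₀, hl₀, hlx⟩ := mem_litsOf.1 hx
  obtain ⟨φ, hφ⟩ := hF.1.2.2 (F.filter fun C => ∀ l ∈ C, l ∉ S ∧ Lit.compl l ∉ S) (by
    refine Finset.filter_ssubset.2 ⟨C₀, hC₀, fun h => ?_⟩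
    rcases eq_or_eq_compl hlx with rfl | rfl
    · exact (h _ hl₀).1 hxS
    · exact (h _ hl₀).2 (by rwa [compl_invol]))
  let ψ : ℕ → Bool := fun v => if (v, true) ∈ S then true else if (v, false) ∈ S then false else φ v
  have h1 : ∀ l ∈ S, LitVal ψ l = true := by
    rintro ⟨n, b⟩ hl
    have := hcons _ hl
    cases b
    · simp only [Lit.compl, Bool.not_false] at this
      simp [LitVal, ψ, hl, this]
    · simp [LitVal, ψ, hl]
  have h2 : ∀ l, l ∉ S → Lit.compl l ∉ S → LitVal ψ l = LitVal φ l := by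
    rintro ⟨n, b⟩ hl hl'
    cases b
    · simp only [Lit.compl, Bool.not_false] at hl'
      simp [LitVal, ψ, hl, hl']
    · simp only [Lit.compl, Bool.not_true] at hl'
      simp [LitVal, ψ, hl, hl']
  refine hF.1.2.1 ⟨ψ, fun C hC => ?_⟩
  by_cases hCS : ∀ l ∈ C, l ∉ S ∧ Lit.compl l ∉ S
  · obtain ⟨l, hl, hv⟩ := hφ C (Finset.mem_filter.2 ⟨hC, hCS⟩)
    exact ⟨l, hl, by rw [h2 l (hCS l hl).1 (hCS l hl).2, hv]⟩
  · push Not at hCS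
    obtain ⟨l, hl, hlS⟩ := hCS
    by_cases hl1 : l ∈ S
    · exact ⟨l, hl, h1 l hl1⟩
    · obtain ⟨b, hb, hCb⟩ := exists_eq_pair (hF.2 C hC) hl
      refine ⟨b, hb, h1 b (Relation.ReflTransGen.tail (hlS hl1) ?_)⟩
      rw [Lit.imp, compl_invol, ← hCb]
      exact hC

/-- A walk along implications of `F` starting at `x`, of length `r`, whose first `r` vertices
have distinct variables, and whose last vertex is the complement of an earlier one. -/
structure Lasso (F : Finset (Finset Lit)) (x : Lit) (r : ℕ) (p : ℕ → Lit) (i : ℕ) : Prop where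
  zero : p 0 = x
  arc : ∀ j < r, imp (p j) (p (j + 1)) ∈ F
  inj : ∀ j < r, ∀ j' < r, (p j).1 = (p j').1 → j = j'
  lt : i < r
  last : p r = Lit.compl (p i)

lemma exists_walk {α : Type*} {R : α → α → Prop} {a b : α} (h : Relation.ReflTransGen R a b) :
    ∃ (N : ℕ) (p : ℕ → α), p 0 = a ∧ p N = b ∧ ∀ j < N, R (p j) (p (j + 1)) := by
  induction h with
  | refl => exact ⟨0, fun _ => a, rfl, rfl, by simp⟩
  | @tail b c _ hbc ih =>
    obtain ⟨N, p, h0, hN, hp⟩ := ih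
    refine ⟨N + 1, fun j => if j ≤ N then p j else c, by simp [h0], by simp, fun j hj => ?_⟩
    by_cases hjN : j = N
    · subst hjN
      simpa [hN] using hbc
    · have h1 : j ≤ N := by omega
      have h2 : j + 1 ≤ N := by omega
      simpa [h1, h2] using hp j (by omega)

lemma MU2.exists_lasso {F : Finset (Finset Lit)} (hF : MU2 F) {x : Lit} (hx : x ∈ litsOf F) :
    ∃ r p i, Lasso F x r p i := by
  classical
  have hex : ∃ N, ∃ p : ℕ → Lit, p 0 = x ∧ p N = Lit.compl x ∧
      ∀ j < N, imp (p j) (p (j + 1)) ∈ F := exists_walk (hF.reaches_compl hx)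
  obtain ⟨p, h0, hN, hp⟩ := Nat.find_spec hex
  set N := Nat.find hex with hNdef
  have hN0 : N ≠ 0 := by
    intro h
    rw [h, h0] at hN
    exact compl_ne x hN.symm
  have hrep : ∃ r, r ≤ N ∧ ∃ i < r, (p i).1 = (p r).1 :=
    ⟨N, le_rfl, 0, by omega, by rw [h0, hN, compl_fst]⟩
  obtain ⟨hrN, i, hir, hvar⟩ := Nat.find_spec hrep
  set r := Nat.find hrep with hr
  refine ⟨r, p, i, h0, fun j hj => hp j (by omega), ?_, hir, ?_⟩
  · intro j hj j' hj' he
    by_contra hne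
    rcases Nat.lt_or_gt_of_ne hne with h | h
    · exact Nat.find_min hrep hj' ⟨by omega, j, h, he⟩
    · exact Nat.find_min hrep hj ⟨by omega, j', h, he.symm⟩
  · rcases eq_or_eq_compl hvar.symm with h | h
    · exfalso
      refine Nat.find_min hex (m := N - (r - i)) (by omega)
        ⟨fun j => if j ≤ i then p j else p (j + (r - i)), by simp [h0], ?_, fun j hj => ?_⟩
      · by_cases hle : N - (r - i) ≤ i
        · have h3 : N - (r - i) = i := by omega
          have h4 : r = N := by omega
          simp only [h3, le_refl, if_true]
          rw [← h, h4, hN]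
        · simp only [hle, if_false]
          rw [Nat.sub_add_cancel (by omega), hN]
      · rcases Nat.lt_trichotomy j i with h5 | h5 | h5
        · simpa [show j ≤ i by omega, show j + 1 ≤ i by omega] using hp j (by omega)
        · subst h5
          have h6 := hp r (by omega)
          simp only [le_refl, if_true, show ¬ (j + 1 ≤ j) by omega, if_false]
          rw [show j + 1 + (r - j) = r + 1 by omega, ← h]
          exact h6
        · simp only [show ¬ (j ≤ i) by omega, show ¬ (j + 1 ≤ i) by omega, if_false]
          rw [show j + 1 + (r - i) = j + (r - i) + 1 by omega]
          exact hp _ (by omega)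
    · exact h

/-- The clauses traversed by the walk `p` of length `r`. -/
def walkClauses (p : ℕ → Lit) (r : ℕ) : Finset (Finset Lit) :=
  (Finset.range r).image fun j => imp (p j) (p (j + 1))

lemma mem_walkClauses {p : ℕ → Lit} {r : ℕ} {C : Finset Lit} :
    C ∈ walkClauses p r ↔ ∃ j < r, C = imp (p j) (p (j + 1)) := by
  simp only [walkClauses, Finset.mem_image, Finset.mem_range, eq_comm]

lemma imp_mem_walkClauses {p : ℕ → Lit} {r j : ℕ} (hj : j < r) :
    imp (p j) (p (j + 1)) ∈ walkClauses p r := mem_walkClauses.2 ⟨j, hj, rfl⟩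

namespace Lasso

variable {F : Finset (Finset Lit)} {x : Lit} {r : ℕ} {p : ℕ → Lit} {i : ℕ}

lemma walkClauses_subset (h : Lasso F x r p i) : walkClauses p r ⊆ F := by
  intro C hC
  obtain ⟨j, hj, rfl⟩ := mem_walkClauses.1 hC
  exact h.arc j hj

lemma not_litVal (h : Lasso F x r p i) {φ : ℕ → Bool} (hφ : Models φ (walkClauses p r)) :
    ¬ LitVal φ x = true := by
  intro hx
  rw [← h.zero] at hx
  have h1 := hφ.chain (p := p) (Nat.zero_le i)
    (fun j _ hj => imp_mem_walkClauses (by have := h.lt; omega)) hx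
  have h2 := hφ.chain (p := p) (Nat.zero_le r) (fun j _ hj => imp_mem_walkClauses hj) hx
  rw [h.last, litVal_compl] at h2
  exact h2 h1

lemma mem_varsOf (h : Lasso F x r p i) {j : ℕ} (hj : j < r) : (p j).1 ∈ varsOf F :=
  _root_.mem_varsOf.2 ⟨_, h.arc j hj, Lit.compl (p j), mem_imp.2 (Or.inl rfl), rfl⟩

lemma le_card (h : Lasso F x r p i) : r ≤ (varsOf F).card := by
  have : ((Finset.range r).image fun j => (p j).1).card = r := by
    rw [Finset.card_image_of_injOn, Finset.card_range]
    intro a ha b hb hab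
    exact h.inj a (by simpa using ha) b (by simpa using hb) hab
  rw [← this]
  refine Finset.card_le_card fun v hv => ?_
  obtain ⟨j, hj, rfl⟩ := Finset.mem_image.1 hv
  exact h.mem_varsOf (Finset.mem_range.1 hj)

lemma eq_union (h : Lasso F x r p i) (hF : MU F) {s : ℕ} {q : ℕ → Lit} {j : ℕ}
    (h' : Lasso F (Lit.compl x) s q j) : F = walkClauses p r ∪ walkClauses q s := by
  symm
  refine hF.eq_of_subset (Finset.union_subset h.walkClauses_subset h'.walkClauses_subset) ?_
  intro φ hφ
  have h1 := h.not_litVal (hφ.mono Finset.subset_union_left)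
  have h2 := h'.not_litVal (hφ.mono Finset.subset_union_right)
  rw [litVal_compl] at h2
  exact h2 h1

lemma eq_zero_of_var_eq (h : Lasso F x r p i) {j : ℕ} (hj : j < r) (he : (p j).1 = x.1) :
    j = 0 :=
  h.inj j hj 0 (by omega) (by rw [he, h.zero])

/-- The base literal of a lasso occurs complemented in at most two clauses of the lasso. -/
lemma compl_mem_cases (h : Lasso F x r p i) {C : Finset Lit} (hC : C ∈ walkClauses p r)
    (hx : Lit.compl x ∈ C) :
    C = imp (p 0) (p 1) ∨ (i = 0 ∧ C = imp (p (r - 1)) (p r)) := by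
  obtain ⟨j, hj, rfl⟩ := mem_walkClauses.1 hC
  rcases mem_imp.1 hx with he | he
  · have := h.eq_zero_of_var_eq hj (by rw [← compl_inj.1 he])
    subst this
    exact Or.inl rfl
  · by_cases hjr : j + 1 < r
    · have := h.eq_zero_of_var_eq hjr (by rw [← he, compl_fst])
      omega
    · have hr : j + 1 = r := by omega
      refine Or.inr ⟨?_, by rw [← hr]; rfl⟩
      rw [hr, h.last, compl_inj] at he
      exact h.eq_zero_of_var_eq h.lt (by rw [he])

lemma notMem_walkClauses (h : Lasso F x r p i) {C : Finset Lit} (hC : C ∈ walkClauses p r) :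
    x ∉ C := by
  obtain ⟨j, hj, rfl⟩ := mem_walkClauses.1 hC
  intro hx
  rcases mem_imp.1 hx with he | he
  · have := h.eq_zero_of_var_eq hj (by rw [he, compl_fst])
    subst this
    rw [h.zero] at he
    exact compl_ne x he.symm
  · by_cases hjr : j + 1 < r
    · have := h.eq_zero_of_var_eq hjr (by rw [← he])
      omega
    · have hr : j + 1 = r := by omega
      rw [hr, h.last] at he
      have := h.eq_zero_of_var_eq h.lt (by rw [he, compl_fst])
      subst this
      rw [h.zero] at he
      exact compl_ne x he.symm

end Lasso

lemma MU2.ldeg_compl {F : Finset (Finset Lit)} (hF : MU2 F) {x : Lit} {r : ℕ} {p : ℕ → Lit}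
    {i : ℕ} (h : Lasso F x r p i) (hx : x ∈ litsOf F) :
    1 ≤ ldeg F (Lit.compl x) ∧ ldeg F (Lit.compl x) ≤ 2 ∧
      (i ≠ 0 → ldeg F (Lit.compl x) ≤ 1) := by
  obtain ⟨s, q, j, h'⟩ := hF.exists_lasso (compl_mem hx)
  have key : ∀ C ∈ F, Lit.compl x ∈ C →
      C = imp (p 0) (p 1) ∨ (i = 0 ∧ C = imp (p (r - 1)) (p r)) := by
    intro C hC hx
    rw [h.eq_union hF.1 h', Finset.mem_union] at hC
    rcases hC with hC | hC
    · exact h.compl_mem_cases hC hx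
    · exact absurd hx (h'.notMem_walkClauses hC)
  have hr := h.lt
  refine ⟨?_, ?_, fun hi => ?_⟩
  · refine Finset.card_pos.2 ⟨imp (p 0) (p 1), Finset.mem_filter.2 ⟨h.arc 0 (by omega), ?_⟩⟩
    rw [h.zero]
    exact mem_imp.2 (Or.inl rfl)
  · refine (Finset.card_le_card (t := {imp (p 0) (p 1), imp (p (r - 1)) (p r)}) ?_).trans
      Finset.card_le_two
    intro C hC
    rw [Finset.mem_filter] at hC
    rcases key C hC.1 hC.2 with h | h
    · simp [h]
    · simp [h.2]
  · refine (Finset.card_le_card (t := {imp (p 0) (p 1)}) ?_).trans (by simp)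
    intro C hC
    rw [Finset.mem_filter] at hC
    rcases key C hC.1 hC.2 with h | h
    · simp [h]
    · exact absurd h.1 hi

lemma MU2.ldeg_bounds {F : Finset (Finset Lit)} (hF : MU2 F) {x : Lit} (hx : x ∈ litsOf F) :
    1 ≤ ldeg F x ∧ ldeg F x ≤ 2 := by
  obtain ⟨r, p, i, h⟩ := hF.exists_lasso (compl_mem hx)
  have := hF.ldeg_compl h (compl_mem hx)
  rw [compl_invol] at this
  exact ⟨this.1, this.2.1⟩

lemma MU2.singleton_notMem {F : Finset (Finset Lit)} (hF : MU2 F) (hd : 2 ≤ deficiency F)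
    (x : Lit) : {x} ∉ F := by
  intro hx
  have hxF : x ∈ litsOf F := mem_litsOf.2 ⟨_, hx, x, by simp, rfl⟩
  obtain ⟨r, p, i, h⟩ := hF.exists_lasso hxF
  have heq : insert {x} (walkClauses p r) = F := by
    refine hF.1.eq_of_subset (Finset.insert_subset hx h.walkClauses_subset) fun φ hφ => ?_
    obtain ⟨l, hl, hv⟩ := hφ {x} (Finset.mem_insert_self _ _)
    rw [Finset.mem_singleton] at hl
    subst hl
    exact h.not_litVal (hφ.mono (Finset.subset_insert _ _)) hv
  have h1 : F.card ≤ r + 1 := by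
    rw [← heq]
    refine (Finset.card_insert_le _ _).trans ?_
    have : (walkClauses p r).card ≤ r := by
      simpa [walkClauses] using
        Finset.card_image_le (s := Finset.range r) (f := fun j => imp (p j) (p (j + 1)))
    omega
  have h2 := h.le_card
  rw [deficiency] at hd
  omega

lemma MU2.eq_pair_of_mem {F : Finset (Finset Lit)} (hF : MU2 F) (hd : 2 ≤ deficiency F)
    {C : Finset Lit} (hC : C ∈ F) {l : Lit} (hl : l ∈ C) : ∃ b, b.1 ≠ l.1 ∧ C = {l, b} := by
  obtain ⟨b, hb, he⟩ := exists_eq_pair (hF.2 C hC) hl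
  refine ⟨b, fun h => ?_, he⟩
  rcases eq_or_eq_compl h with rfl | rfl
  · rw [Finset.pair_eq_singleton] at he
    exact hF.singleton_notMem hd b (he ▸ hC)
  · exact hF.1.1 C hC l hl hb

lemma MU2.exists_eq_pair {F : Finset (Finset Lit)} (hF : MU2 F) (hd : 2 ≤ deficiency F)
    {C : Finset Lit} (hC : C ∈ F) : ∃ l b, b.1 ≠ l.1 ∧ C = {l, b} := by
  have hne : C.Nonempty := by
    rw [Finset.nonempty_iff_ne_empty]
    rintro rfl
    exact hF.1.empty_notMem hd hC
  obtain ⟨l, hl⟩ := hne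
  exact ⟨l, hF.eq_pair_of_mem hd hC hl⟩

section Nonsingular

variable {F : Finset (Finset Lit)} {x : Lit} {r s : ℕ} {p q : ℕ → Lit}

lemma Lasso.exists_var_eq (h : Lasso F x r p 0) {C : Finset Lit} (hC : C ∈ walkClauses p r)
    {y : Lit} (hy : y ∈ C) : ∃ j < r, (p j).1 = y.1 := by
  obtain ⟨j, hj, rfl⟩ := mem_walkClauses.1 hC
  rcases mem_imp.1 hy with rfl | rfl
  · exact ⟨j, hj, rfl⟩
  · by_cases hjr : j + 1 < r
    · exact ⟨j + 1, hjr, rfl⟩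
    · have hr : j + 1 = r := by omega
      exact ⟨0, h.lt, by rw [hr, h.last, compl_fst]⟩

lemma Lasso.clause_unique (h : Lasso F x r p 0) {C C' : Finset Lit} (hC : C ∈ walkClauses p r)
    (hC' : C' ∈ walkClauses p r) {y : Lit} (hyx : y.1 ≠ x.1) (hy : y ∈ C) (hy' : y ∈ C') :
    C = C' := by
  have hlast : ∀ j < r, y = p (j + 1) → j + 1 < r := by
    intro j hj he
    by_contra hjr
    have hr : j + 1 = r := by omega
    rw [hr, h.last, h.zero] at he
    exact hyx (by rw [he, compl_fst])
  have hmix : ∀ j < r, ∀ j' < r, y = Lit.compl (p j) → y ≠ p (j' + 1) := by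
    intro j hj j' hj' he he'
    have h1 := h.inj j hj (j' + 1) (hlast j' hj' he') (by rw [← he', he, compl_fst])
    rw [← h1, he] at he'
    exact compl_ne _ he'
  obtain ⟨j, hj, rfl⟩ := mem_walkClauses.1 hC
  obtain ⟨j', hj', rfl⟩ := mem_walkClauses.1 hC'
  rcases mem_imp.1 hy with he | he <;> rcases mem_imp.1 hy' with he' | he'
  · have := h.inj j hj j' hj' (by rw [compl_inj.1 (he.symm.trans he')])
    rw [this]
  · exact absurd he' (hmix j hj j' hj' he)
  · exact absurd he (hmix j' hj' j hj he')
  · have := h.inj (j + 1) (hlast j hj he) (j' + 1) (hlast j' hj' he') (by rw [← he, he'])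
    rw [show j = j' by omega]

lemma Lasso.disjoint (hF : MU2 F) (hd : 2 ≤ deficiency F) (hdeg : ∀ y ∈ litsOf F, 2 ≤ ldeg F y)
    (h : Lasso F x r p 0) (h' : Lasso F (Lit.compl x) s q 0) {C : Finset Lit}
    (hC : C ∈ walkClauses p r) : C ∉ walkClauses q s := by
  intro hC'
  have hCF := h.walkClauses_subset hC
  obtain ⟨y, hy, hyx⟩ : ∃ y ∈ C, y.1 ≠ x.1 := by
    obtain ⟨l, b, hb, rfl⟩ := hF.exists_eq_pair hd hCF
    by_cases hl : l.1 = x.1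
    · exact ⟨b, by simp, by rwa [← hl]⟩
    · exact ⟨l, by simp, hl⟩
  have h2 : 1 < (F.filter fun C => y ∈ C).card := hdeg y (mem_litsOf.2 ⟨C, hCF, y, hy, rfl⟩)
  obtain ⟨D, hD, hne⟩ := Finset.exists_mem_ne h2 C
  obtain ⟨hDF, hyD⟩ := Finset.mem_filter.1 hD
  rw [h.eq_union hF.1 h', Finset.mem_union] at hDF
  rcases hDF with hDF | hDF
  · exact hne (h.clause_unique hDF hC hyx hyD hy)
  · exact hne (h'.clause_unique hDF hC' hyx hyD hy)

lemma Lasso.covers (hF : MU2 F) (hdeg : ∀ y ∈ litsOf F, 2 ≤ ldeg F y)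
    (h : Lasso F x r p 0) (h' : Lasso F (Lit.compl x) s q 0) {y : Lit} (hy : y ∈ litsOf F) :
    ∃ j < r, (p j).1 = y.1 := by
  by_cases hyx : y.1 = x.1
  · exact ⟨0, h.lt, by rw [h.zero, hyx]⟩
  obtain ⟨C, D, hC, hD, hne⟩ := Finset.one_lt_card_iff.1 (hdeg y hy)
  rw [Finset.mem_filter, h.eq_union hF.1 h', Finset.mem_union] at hC hD
  rcases hC.1 with h1 | h1
  · exact h.exists_var_eq h1 hC.2
  rcases hD.1 with h2 | h2
  · exact h.exists_var_eq h2 hD.2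
  · exact absurd (h'.clause_unique h1 h2 hyx hC.2 hD.2) hne

lemma Lasso.length_eq (hF : MU2 F) (hdeg : ∀ y ∈ litsOf F, 2 ≤ ldeg F y)
    (h : Lasso F x r p 0) (h' : Lasso F (Lit.compl x) s q 0) : r = (varsOf F).card := by
  refine le_antisymm h.le_card ?_
  have : varsOf F ⊆ (Finset.range r).image fun j => (p j).1 := by
    intro v hv
    obtain ⟨j, hj, he⟩ := Lasso.covers hF hdeg h h' (y := (v, true)) (by
      obtain ⟨C, hC, l, hl, he⟩ := _root_.mem_varsOf.1 hv
      exact mem_litsOf.2 ⟨C, hC, l, hl, he⟩)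
    exact Finset.mem_image.2 ⟨j, Finset.mem_range.2 hj, he⟩
  refine (Finset.card_le_card this).trans ?_
  simpa using Finset.card_image_le (s := Finset.range r) (f := fun j => (p j).1)

lemma Lasso.step_lt (hF : MU2 F) (hd : 2 ≤ deficiency F) (hdeg : ∀ y ∈ litsOf F, 2 ≤ ldeg F y)
    (h : Lasso F x r p 0) (h' : Lasso F (Lit.compl x) s q 0)
    (hq : ∃ b < r, q 1 = p b) {i a : ℕ} (hi : i < s) (ha : a ≤ r) (hia : q i = p a) :
    ∃ b < a, q (i + 1) = p b := by
  have hr0 : 0 < r := h.lt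
  have hpr : p r = Lit.compl x := by rw [h.last, h.zero]
  have hqs : q s = x := by rw [h'.last, h'.zero, compl_invol]
  have ha0 : a ≠ 0 := by
    rintro rfl
    rw [h.zero] at hia
    have := h'.eq_zero_of_var_eq hi (by rw [hia, compl_fst])
    rw [this, h'.zero] at hia
    exact compl_ne x hia
  rcases Nat.eq_zero_or_pos i with rfl | hi0
  · have : a = r := by
      by_contra hne
      exact ha0 (h.eq_zero_of_var_eq (by omega) (by rw [← hia, h'.zero, compl_fst]))
    rw [this]
    exact hq
  by_cases his : i + 1 = s
  · exact ⟨0, by omega, by rw [his, hqs, h.zero]⟩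
  have har : a < r := by
    refine lt_of_le_of_ne ha ?_
    rintro rfl
    have := h'.eq_zero_of_var_eq hi (by rw [hia, hpr])
    omega
  set C := imp (q i) (q (i + 1)) with hC
  have hCq : C ∈ walkClauses q s := imp_mem_walkClauses hi
  have hCF : C ∈ F := h'.arc i hi
  have hCp : C ∉ walkClauses p r := fun hc => Lasso.disjoint hF hd hdeg h h' hc hCq
  obtain ⟨b, hb, hbv⟩ := Lasso.covers hF hdeg h h' (y := q (i + 1))
    (mem_litsOf.2 ⟨C, hCF, q (i + 1), mem_imp.2 (Or.inr rfl), rfl⟩)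
  have hab : a ≠ b := by
    rintro rfl
    have := h'.inj i hi (i + 1) (by omega) (by rw [hia, hbv])
    omega
  rcases eq_or_eq_compl hbv.symm with he | he
  · refine ⟨b, ?_, he⟩
    by_contra hlt
    obtain ⟨φ, hφ, hφC⟩ := hF.1.exists_models_erase hCF
    have h1 : LitVal φ (q i) = true := by
      have := hφC (Lit.compl (q i)) (mem_imp.2 (Or.inl rfl))
      rw [litVal_compl] at this
      simpa using this
    have h2 := hφC (q (i + 1)) (mem_imp.2 (Or.inr rfl))
    rw [hia] at h1
    rw [he] at h2
    refine h2 (hφ.chain (show a ≤ b by omega) (fun j _ hj => ?_) h1)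
    refine Finset.mem_erase.2 ⟨fun hc => hCp ?_, h.arc j (by omega)⟩
    rw [← hc]
    exact imp_mem_walkClauses (by omega)
  · exfalso
    set M := max a b with hM
    have hMr : M < r := max_lt har hb
    set D := imp (p M) (p (M + 1)) with hD
    have hDF : D ∈ F := h.arc M hMr
    have hDp : D ∈ walkClauses p r := imp_mem_walkClauses hMr
    obtain ⟨φ, hφ, -⟩ := hF.1.exists_models_erase hDF
    have hx : LitVal φ x = true := by
      have := h'.not_litVal (hφ.mono fun E hE => Finset.mem_erase.2
        ⟨fun he => Lasso.disjoint hF hd hdeg h h' hDp (he ▸ hE), h'.walkClauses_subset hE⟩)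
      rw [litVal_compl] at this
      simpa using this
    have hprefix : ∀ c ≤ M, LitVal φ (p c) = true := by
      intro c hc
      rw [← h.zero] at hx
      refine hφ.chain (Nat.zero_le c) (fun j _ hj => Finset.mem_erase.2 ⟨fun hc' => ?_,
        h.arc j (by omega)⟩) hx
      rw [hD, Lit.imp, Lit.imp, pair_eq_pair] at hc'
      rcases hc' with ⟨e, -⟩ | ⟨-, e⟩
      · have := h.inj j (by omega) M hMr (by rw [compl_inj.1 e])
        omega
      · have := h.inj (j + 1) (by omega) M hMr (by rw [e, compl_fst])
        rw [this] at e
        exact compl_ne _ e.symm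
    obtain ⟨l, hl, hv⟩ := hφ C (Finset.mem_erase.2 ⟨fun e => hCp (e ▸ hDp), hCF⟩)
    rcases mem_imp.1 hl with rfl | rfl
    · rw [litVal_compl, hia] at hv
      exact hv (hprefix a (le_max_left _ _))
    · rw [he, litVal_compl] at hv
      exact hv (hprefix b (le_max_right _ _))

/-- The second lasso runs backwards along the first one. -/
lemma Lasso.eq_reverse (hF : MU2 F) (hd : 2 ≤ deficiency F)
    (hdeg : ∀ y ∈ litsOf F, 2 ≤ ldeg F y)
    (h : Lasso F x r p 0) (h' : Lasso F (Lit.compl x) s q 0)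
    (hq : ∃ b < r, q 1 = p b) : s = r ∧ ∀ i ≤ r, q i = p (r - i) := by
  have hsr : s = r := by
    have h'' : Lasso F (Lit.compl (Lit.compl x)) r p 0 := by rwa [compl_invol]
    rw [Lasso.length_eq hF hdeg h h', Lasso.length_eq hF hdeg h' h'']
  subst hsr
  refine ⟨rfl, ?_⟩
  have hstep := fun {i a : ℕ} => Lasso.step_lt (i := i) (a := a) hF hd hdeg h h' hq
  have hlow : ∀ d ≤ s, ∀ i, i + d = s → ∀ a ≤ s, q i = p a → d ≤ a := by
    intro d
    induction d with
    | zero => intros; omega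
    | succ d ih =>
      intro hds i hi a ha he
      obtain ⟨b, hb, hqb⟩ := hstep (by omega) ha he
      have := ih (by omega) (i + 1) (by omega) b (by omega) hqb
      omega
  have hup : ∀ i ≤ s, ∃ a, a + i ≤ s ∧ q i = p a := by
    intro i
    induction i with
    | zero => exact fun _ => ⟨s, by omega, by rw [h'.zero, h.last, h.zero]⟩
    | succ i ih =>
      intro hi
      obtain ⟨a, ha, he⟩ := ih (by omega)
      obtain ⟨b, hb, hqb⟩ := hstep (by omega) (by omega) he
      exact ⟨b, by omega, hqb⟩
  intro i hi
  obtain ⟨a, ha, he⟩ := hup i hi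
  have := hlow (s - i) (by omega) i (by omega) a (by omega) he
  rw [he, show a = s - i by omega]

lemma Lasso.reverse (h : Lasso F x r p 0) : Lasso F x r (fun j => Lit.compl (p (r - j))) 0 where
  zero := by simp [h.last, h.zero]
  arc j hj := by
    rw [imp_compl]
    have := h.arc (r - (j + 1)) (by omega)
    rwa [show r - (j + 1) + 1 = r - j by omega] at this
  inj j hj j' hj' he := by
    have hv : ∀ k < r, (p (r - k)).1 = (p (if k = 0 then 0 else r - k)).1 := by
      intro k hk
      split_ifs with h0
      · rw [h0, Nat.sub_zero, h.last, compl_fst]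
      · rfl
    simp only [compl_fst] at he
    rw [hv j hj, hv j' hj'] at he
    have := h.inj _ (by split_ifs <;> omega) _ (by split_ifs <;> omega) he
    split_ifs at this <;> omega
  lt := h.lt
  last := by simp [h.last, h.zero]

lemma MU2.exists_double_lasso (hF : MU2 F) (hd : 2 ≤ deficiency F)
    (hdeg : ∀ y ∈ litsOf F, 2 ≤ ldeg F y) :
    ∃ x p, Lasso F x (varsOf F).card p 0 ∧ ∀ C, C ∈ F ↔ ∃ j < (varsOf F).card,
      C = imp (p j) (p (j + 1)) ∨ C = imp (p (j + 1)) (p j) := by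
  have hFne : F.Nonempty := by
    rw [Finset.nonempty_iff_ne_empty]
    rintro rfl
    simp [deficiency, varsOf] at hd
  obtain ⟨C, hC⟩ := hFne
  obtain ⟨x, b, -, rfl⟩ := hF.exists_eq_pair hd hC
  have hx : x ∈ litsOf F := mem_litsOf.2 ⟨_, hC, x, by simp, rfl⟩
  have hlasso : ∀ y ∈ litsOf F, ∃ r p, Lasso F y r p 0 := by
    intro y hy
    obtain ⟨r, p, i, h⟩ := hF.exists_lasso hy
    have h1 := (hF.ldeg_compl h hy).2.2
    have h2 := hdeg _ (compl_mem hy)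
    have h3 : i = 0 := by
      by_contra hne
      have := h1 hne
      omega
    exact ⟨r, p, h3 ▸ h⟩
  obtain ⟨r, p, h⟩ := hlasso x hx
  obtain ⟨s, q, h'⟩ := hlasso _ (compl_mem hx)
  have hr := Lasso.length_eq hF hdeg h h'
  have key : ∀ p, Lasso F x r p 0 → (∃ b < r, q 1 = p b) →
    ∃ x p, Lasso F x (varsOf F).card p 0 ∧ ∀ C, C ∈ F ↔ ∃ j < (varsOf F).card,
      C = imp (p j) (p (j + 1)) ∨ C = imp (p (j + 1)) (p j) := by
    intro p h hq
    obtain ⟨rfl, hrev⟩ := Lasso.eq_reverse hF hd hdeg h h' hq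
    rw [← hr]
    refine ⟨x, p, h, fun C => ?_⟩
    conv_lhs => rw [h.eq_union hF.1 h', Finset.mem_union, mem_walkClauses, mem_walkClauses]
    constructor
    · rintro (⟨j, hj, rfl⟩ | ⟨j, hj, rfl⟩)
      · exact ⟨j, hj, Or.inl rfl⟩
      · refine ⟨s - (j + 1), by omega, Or.inr ?_⟩
        rw [hrev j (by omega), hrev (j + 1) (by omega), show s - (j + 1) + 1 = s - j by omega]
    · rintro ⟨j, hj, rfl | rfl⟩
      · exact Or.inl ⟨j, hj, rfl⟩
      · refine Or.inr ⟨s - (j + 1), by omega, ?_⟩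
        rw [hrev _ (by omega), hrev _ (by omega), show s - (s - (j + 1)) = j + 1 by omega,
          show s - (s - (j + 1) + 1) = j by omega]
  have hs0 : 0 < s := h'.lt
  have hx1 : q 1 ∈ litsOf F := mem_litsOf.2 ⟨_, h'.arc 0 hs0, q 1, mem_imp.2 (Or.inr rfl), rfl⟩
  obtain ⟨b, hb, hbv⟩ := Lasso.covers hF hdeg h h' hx1
  rcases eq_or_eq_compl hbv.symm with he | he
  · exact key p h ⟨b, hb, he⟩
  · refine key _ h.reverse ?_
    by_cases hb0 : b = 0
    · subst hb0
      exfalso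
      have h1 := h'.arc 0 hs0
      rw [Lit.imp, he, h'.zero, h.zero] at h1
      rw [compl_invol] at h1
      exact hF.1.1 _ h1 x (by simp) (by simp)
    · exact ⟨r - b, by omega, by rw [he, show r - (r - b) = b by omega]⟩

end Nonsingular

section Resolution

variable {R : Finset (Finset Lit)} {v a : Lit} {B : Finset Lit}

/-- The result of resolving the only clause `{v, a}` containing `v` with all clauses `{v̄, b}`. -/
def resolved (R : Finset (Finset Lit)) (a : Lit) (B : Finset Lit) : Finset (Finset Lit) :=
  R ∪ B.image fun b => {a, b}

/-- A 2-clause-set in which `v` occurs only in the clause `{v, a}`, and `v̄` only in the clauses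
`{v̄, b}` for `b ∈ B`. -/
def unresolved (R : Finset (Finset Lit)) (v a : Lit) (B : Finset Lit) : Finset (Finset Lit) :=
  insert {v, a} (R ∪ B.image fun b => {Lit.compl v, b})

lemma mem_resolved {C : Finset Lit} :
    C ∈ resolved R a B ↔ C ∈ R ∨ ∃ b ∈ B, C = {a, b} := by
  simp only [resolved, Finset.mem_union, Finset.mem_image, eq_comm]

lemma mem_unresolved {C : Finset Lit} :
    C ∈ unresolved R v a B ↔ C = {v, a} ∨ C ∈ R ∨ ∃ b ∈ B, C = {Lit.compl v, b} := by
  simp only [unresolved, Finset.mem_insert, Finset.mem_union, Finset.mem_image, eq_comm]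

lemma pair_right_inj {c b d : Lit} (h : ({c, b} : Finset Lit) = {c, d}) : b = d := by
  rcases pair_eq_pair.1 h with ⟨-, h⟩ | ⟨h1, h2⟩
  · exact h
  · exact h2.trans h1

lemma unresolved_spec (hR : ∀ C ∈ R, ∀ l ∈ C, l.1 ≠ v.1) (ha : a.1 ≠ v.1)
    (hF : MU (unresolved R v a B)) {b : Lit} (hb : b ∈ B) :
    ∃ φ, ¬ LitVal φ a = true ∧ ¬ LitVal φ b = true ∧ Models φ R ∧
      ∀ b' ∈ B, b' ≠ b → LitVal φ b' = true := by
  have hbF : {Lit.compl v, b} ∈ unresolved R v a B := mem_unresolved.2 (.inr (.inr ⟨b, hb, rfl⟩))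
  obtain ⟨φ, hφ, hfalse⟩ := hF.exists_models_erase hbF
  have hv : LitVal φ v = true := by
    have := hfalse (Lit.compl v) (by simp)
    rw [litVal_compl] at this
    simpa using this
  have hRφ : Models φ R := hφ.mono fun C hC => Finset.mem_erase.2
    ⟨fun h => hR C hC (Lit.compl v) (by rw [h]; simp) rfl, mem_unresolved.2 (.inr (.inl hC))⟩
  refine ⟨φ, fun hav => ?_, hfalse b (by simp), hRφ, fun b' hb' hne => ?_⟩
  · obtain ⟨ψ, hψv, hψ⟩ := exists_assign φ (Lit.compl v)
    refine hF.not_models ψ fun C hC => ?_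
    rcases mem_unresolved.1 hC with rfl | hC | ⟨b', -, rfl⟩
    · exact ⟨a, by simp, by rw [hψ a ha, hav]⟩
    · obtain ⟨l, hl, hlv⟩ := hRφ C hC
      exact ⟨l, hl, by rw [hψ l (hR C hC l hl), hlv]⟩
    · exact ⟨_, by simp, hψv⟩
  · obtain ⟨l, hl, hlv⟩ := hφ {Lit.compl v, b'} (Finset.mem_erase.2
      ⟨fun h => hne (pair_right_inj h), mem_unresolved.2 (.inr (.inr ⟨b', hb', rfl⟩))⟩)
    rw [Finset.mem_insert, Finset.mem_singleton] at hl
    rcases hl with rfl | rfl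
    · exact absurd hlv (hfalse _ (by simp))
    · exact hlv

lemma notMem_of_mu (hR : ∀ C ∈ R, ∀ l ∈ C, l.1 ≠ v.1) (ha : a.1 ≠ v.1)
    (hF : MU (unresolved R v a B)) {b : Lit} (hb : b ∈ B) :
    {a, b} ∉ R := by
  intro h
  obtain ⟨φ, h1, h2, h3, -⟩ := unresolved_spec hR ha hF hb
  obtain ⟨l, hl, hlv⟩ := h3 _ h
  rw [Finset.mem_insert, Finset.mem_singleton] at hl
  rcases hl with rfl | rfl
  · exact h1 hlv
  · exact h2 hlv

lemma ne_compl_of_mu (hR : ∀ C ∈ R, ∀ l ∈ C, l.1 ≠ v.1) (ha : a.1 ≠ v.1)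
    (hF : MU (unresolved R v a B)) {b : Lit} (hb : b ∈ B) :
    b ≠ Lit.compl a := by
  rintro rfl
  obtain ⟨φ, h1, h2, -, -⟩ := unresolved_spec hR ha hF hb
  rw [litVal_compl] at h2
  exact h2 h1

lemma mu2_resolved (hR : ∀ C ∈ R, ∀ l ∈ C, l.1 ≠ v.1) (ha : a.1 ≠ v.1)
    (hB : ∀ b ∈ B, b.1 ≠ v.1) (hF : MU2 (unresolved R v a B)) : MU2 (resolved R a B) := by
  refine ⟨⟨?_, ?_, ?_⟩, ?_⟩
  · intro C hC
    rcases mem_resolved.1 hC with hC | ⟨b, hb, rfl⟩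
    · exact hF.1.1 C (mem_unresolved.2 (.inr (.inl hC)))
    · have hne := ne_compl_of_mu hR ha hF.1 hb
      intro l hl hl'
      simp only [Finset.mem_insert, Finset.mem_singleton] at hl hl'
      rcases hl with rfl | rfl <;> rcases hl' with h | h
      · exact compl_ne _ h
      · exact hne h.symm
      · exact hne (compl_eq_iff.1 h)
      · exact compl_ne _ h
  · rintro ⟨φ, hφ⟩
    obtain ⟨w, hw, hwv⟩ : ∃ w : Lit, w.1 = v.1 ∧ (w = v ↔ ¬ LitVal φ a = true) := by
      by_cases h : LitVal φ a = true
      · exact ⟨Lit.compl v, rfl, by simp [h, compl_ne]⟩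
      · exact ⟨v, rfl, by simp [h]⟩
    obtain ⟨ψ, hψw, hψ⟩ := exists_assign φ w
    refine hF.1.not_models ψ fun C hC => ?_
    rcases mem_unresolved.1 hC with rfl | hC | ⟨b, hb, rfl⟩
    · by_cases h : LitVal φ a = true
      · exact ⟨a, by simp, by rw [hψ a (by rwa [hw]), h]⟩
      · exact ⟨v, by simp, by rwa [hwv.2 h] at hψw⟩
    · obtain ⟨l, hl, hlv⟩ := hφ C (mem_resolved.2 (.inl hC))
      exact ⟨l, hl, by rw [hψ l (by rw [hw]; exact hR C hC l hl), hlv]⟩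
    · by_cases h : LitVal φ a = true
      · rcases eq_or_eq_compl hw with h1 | h1
        · exact absurd h (hwv.1 h1)
        · exact ⟨Lit.compl v, by simp, by rwa [h1] at hψw⟩
      · obtain ⟨l, hl, hlv⟩ := hφ {a, b} (mem_resolved.2 (.inr ⟨b, hb, rfl⟩))
        rw [Finset.mem_insert, Finset.mem_singleton] at hl
        rcases hl with rfl | rfl
        · exact absurd hlv h
        · exact ⟨l, by simp, by rw [hψ l (by rw [hw]; exact hB l hb), hlv]⟩
  · have key : ∀ C ∈ resolved R a B, ∃ φ, Models φ ((resolved R a B).erase C) := by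
      intro C hC
      rcases mem_resolved.1 hC with hC | ⟨b, hb, rfl⟩
      · obtain ⟨φ, hφ, -⟩ := hF.1.exists_models_erase (mem_unresolved.2 (.inr (.inl hC)))
        refine ⟨φ, fun D hD => ?_⟩
        obtain ⟨hDC, hD⟩ := Finset.mem_erase.1 hD
        rcases mem_resolved.1 hD with hD | ⟨b, hb, rfl⟩
        · exact hφ D (Finset.mem_erase.2 ⟨hDC, mem_unresolved.2 (.inr (.inl hD))⟩)
        · obtain ⟨l, hl, hlv⟩ := hφ {v, a} (Finset.mem_erase.2
            ⟨fun h => hR C hC v (by rw [← h]; simp) rfl, mem_unresolved.2 (.inl rfl)⟩)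
          obtain ⟨l', hl', hlv'⟩ := hφ {Lit.compl v, b} (Finset.mem_erase.2
            ⟨fun h => hR C hC (Lit.compl v) (by rw [← h]; simp) rfl,
              mem_unresolved.2 (.inr (.inr ⟨b, hb, rfl⟩))⟩)
          rw [Finset.mem_insert, Finset.mem_singleton] at hl hl'
          rcases hl with rfl | rfl
          · rcases hl' with rfl | rfl
            · exact absurd hlv ((litVal_compl _ _).1 hlv')
            · exact ⟨l', by simp, hlv'⟩
          · exact ⟨l, by simp, hlv⟩
      · obtain ⟨φ, -, -, h3, h4⟩ := unresolved_spec hR ha hF.1 hb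
        refine ⟨φ, fun D hD => ?_⟩
        obtain ⟨hDC, hD⟩ := Finset.mem_erase.1 hD
        rcases mem_resolved.1 hD with hD | ⟨b', hb', rfl⟩
        · exact h3 D hD
        · exact ⟨b', by simp, h4 b' hb' fun h => hDC (by rw [h])⟩
    intro G hG
    obtain ⟨C, hC, hCG⟩ := Finset.ssubset_iff_exists_subset_erase.1 hG
    obtain ⟨φ, hφ⟩ := key C hC
    exact ⟨φ, hφ.mono hCG⟩
  · intro C hC
    rcases mem_resolved.1 hC with hC | ⟨b, hb, rfl⟩
    · exact hF.2 C (mem_unresolved.2 (.inr (.inl hC)))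
    · exact Finset.card_le_two

lemma notMem_varsOf_resolved (hR : ∀ C ∈ R, ∀ l ∈ C, l.1 ≠ v.1) (ha : a.1 ≠ v.1)
    (hB : ∀ b ∈ B, b.1 ≠ v.1) : v.1 ∉ varsOf (resolved R a B) := by
  rw [mem_varsOf]
  rintro ⟨C, hC, l, hl, he⟩
  rcases mem_resolved.1 hC with hC | ⟨b, hb, rfl⟩
  · exact hR C hC l hl he
  · rw [Finset.mem_insert, Finset.mem_singleton] at hl
    rcases hl with rfl | rfl
    · exact ha he
    · exact hB _ hb he

lemma varsOf_unresolved (hne : B.Nonempty) :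
    varsOf (unresolved R v a B) = insert v.1 (varsOf (resolved R a B)) := by
  obtain ⟨b₀, hb₀⟩ := hne
  ext n
  rw [Finset.mem_insert, mem_varsOf, mem_varsOf]
  constructor
  · rintro ⟨C, hC, l, hl, rfl⟩
    rcases mem_unresolved.1 hC with rfl | hC | ⟨b, hb, rfl⟩
    · rw [Finset.mem_insert, Finset.mem_singleton] at hl
      rcases hl with rfl | rfl
      · exact .inl rfl
      · exact .inr ⟨_, mem_resolved.2 (.inr ⟨b₀, hb₀, rfl⟩), l, by simp, rfl⟩
    · exact .inr ⟨C, mem_resolved.2 (.inl hC), l, hl, rfl⟩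
    · rw [Finset.mem_insert, Finset.mem_singleton] at hl
      rcases hl with rfl | rfl
      · exact .inl rfl
      · exact .inr ⟨_, mem_resolved.2 (.inr ⟨l, hb, rfl⟩), l, by simp, rfl⟩
  · rintro (rfl | ⟨C, hC, l, hl, rfl⟩)
    · exact ⟨_, mem_unresolved.2 (.inl rfl), v, by simp, rfl⟩
    · rcases mem_resolved.1 hC with hC | ⟨b, hb, rfl⟩
      · exact ⟨C, mem_unresolved.2 (.inr (.inl hC)), l, hl, rfl⟩
      · rw [Finset.mem_insert, Finset.mem_singleton] at hl
        rcases hl with rfl | rfl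
        · exact ⟨_, mem_unresolved.2 (.inl rfl), l, by simp, rfl⟩
        · exact ⟨_, mem_unresolved.2 (.inr (.inr ⟨l, hb, rfl⟩)), l, by simp, rfl⟩

lemma card_varsOf_unresolved (hR : ∀ C ∈ R, ∀ l ∈ C, l.1 ≠ v.1) (ha : a.1 ≠ v.1)
    (hB : ∀ b ∈ B, b.1 ≠ v.1) (hne : B.Nonempty) :
    (varsOf (unresolved R v a B)).card = (varsOf (resolved R a B)).card + 1 := by
  rw [varsOf_unresolved hne, Finset.card_insert_of_notMem (notMem_varsOf_resolved hR ha hB)]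

lemma deficiency_resolved (hR : ∀ C ∈ R, ∀ l ∈ C, l.1 ≠ v.1) (ha : a.1 ≠ v.1)
    (hB : ∀ b ∈ B, b.1 ≠ v.1) (hne : B.Nonempty) (hF : MU (unresolved R v a B)) :
    deficiency (resolved R a B) = deficiency (unresolved R v a B) := by
  have himg : ∀ c : Lit, (B.image fun b => ({c, b} : Finset Lit)).card = B.card := fun c =>
    Finset.card_image_of_injective _ fun _ _ h => pair_right_inj h
  have h1 : (resolved R a B).card = R.card + B.card := by
    rw [resolved, Finset.card_union_of_disjoint, himg]
    rw [Finset.disjoint_left]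
    intro C hC hC'
    obtain ⟨b, hb, rfl⟩ := Finset.mem_image.1 hC'
    exact notMem_of_mu hR ha hF hb hC
  have h2 : (unresolved R v a B).card = R.card + B.card + 1 := by
    rw [unresolved, Finset.card_insert_of_notMem, Finset.card_union_of_disjoint, himg]
    · rw [Finset.disjoint_left]
      intro C hC hC'
      obtain ⟨b, hb, rfl⟩ := Finset.mem_image.1 hC'
      exact hR _ hC (Lit.compl v) (by simp) rfl
    · rw [Finset.mem_union, Finset.mem_image]
      rintro (h | ⟨b, hb, h⟩)
      · exact hR _ h v (by simp) rfl
      · rcases pair_eq_pair.1 h with ⟨h, -⟩ | ⟨h, -⟩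
        · exact compl_ne _ h
        · exact ha (by rw [← h, compl_fst])
  rw [deficiency, deficiency, h1, h2, card_varsOf_unresolved hR ha hB hne]
  push_cast
  ring

/-- A 2-clause-set with a literal of degree one has the shape required for resolution. -/
lemma MU2.exists_unresolved {F : Finset (Finset Lit)} (hF : MU2 F) (hd : 2 ≤ deficiency F)
    {v : Lit} (hv : ldeg F v = 1) : ∃ R a B, F = unresolved R v a B ∧
      (∀ C ∈ R, ∀ l ∈ C, l.1 ≠ v.1) ∧ a.1 ≠ v.1 ∧ (∀ b ∈ B, b.1 ≠ v.1) ∧ B.Nonempty := by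
  obtain ⟨C₀, hC₀⟩ := Finset.card_eq_one.1 hv
  have hC₀' := Finset.ext_iff.1 hC₀
  simp only [Finset.mem_filter, Finset.mem_singleton] at hC₀'
  obtain ⟨hC₀F, hvC₀⟩ := (hC₀' C₀).2 rfl
  obtain ⟨a, ha, rfl⟩ := hF.eq_pair_of_mem hd hC₀F hvC₀
  have hvF : v ∈ litsOf F := mem_litsOf.2 ⟨_, hC₀F, v, hvC₀, rfl⟩
  have hneg : ∀ C ∈ F, Lit.compl v ∈ C → ∃ b, b.1 ≠ v.1 ∧ C = {Lit.compl v, b} := fun C hC hl =>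
    hF.eq_pair_of_mem hd hC hl
  have hBmem : ∀ b, b ∈ (litsOf F).filter (fun b => {Lit.compl v, b} ∈ F) ↔
      {Lit.compl v, b} ∈ F := fun b => by
    rw [Finset.mem_filter, and_iff_right_iff_imp]
    exact fun h => mem_litsOf.2 ⟨_, h, b, by simp, rfl⟩
  refine ⟨F.filter fun C => ∀ l ∈ C, l.1 ≠ v.1, a,
    (litsOf F).filter (fun b => {Lit.compl v, b} ∈ F), ?_, ?_, ha, ?_, ?_⟩
  · ext C
    rw [mem_unresolved, Finset.mem_filter]
    simp only [hBmem]
    constructor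
    · intro hC
      by_cases h1 : v ∈ C
      · exact .inl ((hC₀' C).1 ⟨hC, h1⟩)
      by_cases h2 : Lit.compl v ∈ C
      · obtain ⟨b, -, rfl⟩ := hneg C hC h2
        exact .inr (.inr ⟨b, hC, rfl⟩)
      · refine .inr (.inl ⟨hC, fun l hl he => ?_⟩)
        rcases eq_or_eq_compl he with rfl | rfl
        · exact h1 hl
        · exact h2 hl
    · rintro (rfl | ⟨hC, -⟩ | ⟨b, hb, rfl⟩)
      · exact hC₀F
      · exact hC
      · exact hb
  · exact fun C hC => (Finset.mem_filter.1 hC).2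
  · intro b hb
    rw [hBmem] at hb
    obtain ⟨c, hc, he⟩ := hneg _ hb (by simp)
    rwa [pair_right_inj he]
  · have := (hF.ldeg_bounds (compl_mem hvF)).1
    obtain ⟨C, hC⟩ := Finset.card_pos.1 this
    obtain ⟨hCF, hC⟩ := Finset.mem_filter.1 hC
    obtain ⟨b, -, rfl⟩ := hneg C hCF hC
    exact ⟨b, (hBmem b).2 hCF⟩

end Resolution

namespace FinDigraph

variable {α : Type}

/-- The image of a digraph under a relabelling of its vertices. -/
def relabel (e : α ≃ α) (G : FinDigraph α) : FinDigraph α :=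
  ⟨G.V.map e.toEmbedding, G.E.map (e.prodCongr e).toEmbedding⟩

lemma mem_relabel_V {e : α ≃ α} {G : FinDigraph α} {a : α} :
    a ∈ (G.relabel e).V ↔ e.symm a ∈ G.V := Finset.mem_map_equiv

lemma mem_relabel_E {e : α ≃ α} {G : FinDigraph α} {a b : α} :
    (a, b) ∈ (G.relabel e).E ↔ (e.symm a, e.symm b) ∈ G.E := Finset.mem_map_equiv

end FinDigraph

section Splitting

variable {α : Type} [DecidableEq α]

lemma splitVertex_iff {G G' : FinDigraph α} : SplitVertex G G' ↔
    ∃ x u v, x ∈ G.V ∧ u ∉ G.V ∧ v ∉ G.V ∧ u ≠ v ∧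
      (∀ a, a ∈ G'.V ↔ a = u ∨ a = v ∨ a ≠ x ∧ a ∈ G.V) ∧
      ∀ a b, (a, b) ∈ G'.E ↔ (a = u ∧ b = v) ∨ ((a, b) ∈ G.E ∧ a ≠ x ∧ b ≠ x) ∨
        ((a, x) ∈ G.E ∧ b = u) ∨ ((x, b) ∈ G.E ∧ a = v) := by
  unfold SplitVertex
  refine exists_congr fun x => exists_congr fun u => exists_congr fun v => ?_
  refine and_congr_right fun _ => and_congr_right fun _ => and_congr_right fun _ =>
    and_congr_right fun _ => and_congr ?_ ?_
  · rw [Finset.ext_iff]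
    simp only [Finset.mem_insert, Finset.mem_erase]
  · rw [Finset.ext_iff, Prod.forall]
    refine forall_congr' fun a => forall_congr' fun b => ?_
    simp only [Finset.mem_insert, Finset.mem_union, Finset.mem_image, Finset.mem_filter,
      Prod.exists, Prod.mk.injEq]
    have h1 : (∃ c d, ((c, d) ∈ G.E ∧ d = x) ∧ c = a ∧ u = b) ↔ (a, x) ∈ G.E ∧ b = u := by
      aesop
    have h2 : (∃ c d, ((c, d) ∈ G.E ∧ c = x) ∧ v = a ∧ d = b) ↔ (x, b) ∈ G.E ∧ a = v := by
      aesop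
    rw [h1, h2, or_assoc]

lemma splitArc_iff {G G' : FinDigraph α} : SplitArc G G' ↔
    ∃ x y v, (x, y) ∈ G.E ∧ v ∉ G.V ∧ (∀ a, a ∈ G'.V ↔ a = v ∨ a ∈ G.V) ∧
      ∀ a b, (a, b) ∈ G'.E ↔ (a = x ∧ b = v) ∨ (a = v ∧ b = y) ∨
        (¬ (a = x ∧ b = y) ∧ (a, b) ∈ G.E) := by
  unfold SplitArc
  simp only [Finset.ext_iff, Prod.forall, Finset.mem_insert, Finset.mem_erase, Prod.mk.injEq,
    ne_eq]

lemma SplitVertex.relabel {G G' : FinDigraph α} (h : SplitVertex G G') (e : α ≃ α) :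
    SplitVertex (G.relabel e) (G'.relabel e) := by
  rw [splitVertex_iff] at h ⊢
  obtain ⟨x, u, v, hx, hu, hv, huv, hV, hE⟩ := h
  refine ⟨e x, e u, e v, ?_, ?_, ?_, ?_, ?_, ?_⟩ <;>
    simp [FinDigraph.mem_relabel_V, FinDigraph.mem_relabel_E, Equiv.symm_apply_eq, *]

lemma SplitArc.relabel {G G' : FinDigraph α} (h : SplitArc G G') (e : α ≃ α) :
    SplitArc (G.relabel e) (G'.relabel e) := by
  rw [splitArc_iff] at h ⊢
  obtain ⟨x, y, v, hxy, hv, hV, hE⟩ := h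
  refine ⟨e x, e y, e v, ?_, ?_, ?_, ?_⟩ <;>
    simp [FinDigraph.mem_relabel_V, FinDigraph.mem_relabel_E, Equiv.symm_apply_eq, *]

lemma IsDoubleCycle.relabel {m : ℕ} {G : FinDigraph α} (h : IsDoubleCycle m G) (e : α ≃ α) :
    IsDoubleCycle m (G.relabel e) := by
  obtain ⟨hm, f, hf, hE⟩ := h
  refine ⟨hm, e ∘ f, ?_, ?_⟩
  · have h1 : Set.BijOn e (G.V : Set α) ((G.relabel e).V : Set α) := by
      refine ⟨fun a ha => ?_, e.injective.injOn, fun b hb => ⟨e.symm b, ?_, by simp⟩⟩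
      · simpa [FinDigraph.mem_relabel_V] using ha
      · simpa [FinDigraph.mem_relabel_V] using hb
    exact h1.comp hf
  · ext ⟨a, b⟩
    rw [FinDigraph.mem_relabel_E, ← hE]
    simp [Equiv.eq_symm_apply]

lemma IsWDC.relabel {m : ℕ} {G : FinDigraph α} (h : IsWDC m G) (e : α ≃ α) :
    IsWDC m (G.relabel e) := by
  obtain ⟨G₀, h₀, hG⟩ := h
  exact ⟨G₀.relabel e, h₀.relabel e, hG.lift _ fun _ _ hab =>
    hab.imp (fun h => h.relabel e) fun h => h.relabel e⟩

lemma IsWDC.splitVertex {m : ℕ} {G G' : FinDigraph α} (h : IsWDC m G) (hG : SplitVertex G G') :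
    IsWDC m G' := by
  obtain ⟨G₀, h₀, h⟩ := h
  exact ⟨G₀, h₀, h.tail (.inl hG)⟩

lemma IsWDC.splitArc {m : ℕ} {G G' : FinDigraph α} (h : IsWDC m G) (hG : SplitArc G G') :
    IsWDC m G' := by
  obtain ⟨G₀, h₀, h⟩ := h
  exact ⟨G₀, h₀, h.tail (.inr hG)⟩

/-- A vertex may be split in such a way that the new source of arcs has a new name. -/
lemma IsWDC.splitVertex_out [Infinite α] {m : ℕ} {G G' : FinDigraph α} (h : IsWDC m G) {x v : α}
    (hG : ∀ a b, (a, b) ∈ G.E → a ∈ G.V ∧ b ∈ G.V) (hx : x ∈ G.V) (hxx : (x, x) ∉ G.E)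
    (hv : v ∉ G.V) (hV : ∀ a, a ∈ G'.V ↔ a = v ∨ a ∈ G.V)
    (hE : ∀ a b, (a, b) ∈ G'.E ↔ (a = x ∧ b = v) ∨ ((a, b) ∈ G.E ∧ a ≠ x) ∨
      ((x, b) ∈ G.E ∧ a = v)) : IsWDC m G' := by
  obtain ⟨t, ht⟩ := Infinite.exists_notMem_finset (insert v G.V)
  rw [Finset.mem_insert, not_or] at ht
  obtain ⟨htv, htV⟩ := ht
  refine (h.relabel (Equiv.swap x t)).splitVertex (splitVertex_iff.2 ⟨t, x, v, ?_, ?_, ?_, ?_,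
    fun a => ?_, fun a b => ?_⟩)
  · simpa [FinDigraph.mem_relabel_V] using hx
  · simpa [FinDigraph.mem_relabel_V] using htV
  · rw [FinDigraph.mem_relabel_V, Equiv.symm_swap, Equiv.swap_apply_of_ne_of_ne]
    · exact hv
    · rintro rfl; exact hv hx
    · exact Ne.symm htv
  · rintro rfl; exact hv hx
  · rw [hV, FinDigraph.mem_relabel_V, Equiv.symm_swap, Equiv.swap_apply_def]
    grind
  · rw [hE]
    simp only [FinDigraph.mem_relabel_E, Equiv.symm_swap, Equiv.swap_apply_def]
    grind

/-- A vertex may be split in such a way that the new target of arcs has a new name. -/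
lemma IsWDC.splitVertex_in [Infinite α] {m : ℕ} {G G' : FinDigraph α} (h : IsWDC m G) {x u : α}
    (hG : ∀ a b, (a, b) ∈ G.E → a ∈ G.V ∧ b ∈ G.V) (hx : x ∈ G.V) (hxx : (x, x) ∉ G.E)
    (hu : u ∉ G.V) (hV : ∀ a, a ∈ G'.V ↔ a = u ∨ a ∈ G.V)
    (hE : ∀ a b, (a, b) ∈ G'.E ↔ (a = u ∧ b = x) ∨ ((a, b) ∈ G.E ∧ b ≠ x) ∨
      ((a, x) ∈ G.E ∧ b = u)) : IsWDC m G' := by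
  obtain ⟨t, ht⟩ := Infinite.exists_notMem_finset (insert u G.V)
  rw [Finset.mem_insert, not_or] at ht
  obtain ⟨htu, htV⟩ := ht
  refine (h.relabel (Equiv.swap x t)).splitVertex (splitVertex_iff.2 ⟨t, u, x, ?_, ?_, ?_, ?_,
    fun a => ?_, fun a b => ?_⟩)
  · simpa [FinDigraph.mem_relabel_V] using hx
  · rw [FinDigraph.mem_relabel_V, Equiv.symm_swap, Equiv.swap_apply_of_ne_of_ne]
    · exact hu
    · rintro rfl; exact hu hx
    · exact Ne.symm htu
  · simpa [FinDigraph.mem_relabel_V] using htV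
  · rintro rfl; exact hu hx
  · rw [hV, FinDigraph.mem_relabel_V, Equiv.symm_swap, Equiv.swap_apply_def]
    grind
  · rw [hE]
    simp only [FinDigraph.mem_relabel_E, Equiv.symm_swap, Equiv.swap_apply_def]
    grind

end Splitting

section ImplicationDigraph

lemma FinDigraph.exists_of_arcs {α : Type} (V : Finset α) (P : α → α → Prop)
    (hP : ∀ a b, P a b → a ∈ V ∧ b ∈ V) :
    ∃ G : FinDigraph α, G.V = V ∧ (∀ a b, (a, b) ∈ G.E ↔ P a b) ∧
      ∀ a b, (a, b) ∈ G.E → a ∈ G.V ∧ b ∈ G.V := by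
  classical
  have hE : ∀ a b, (a, b) ∈ (V ×ˢ V).filter (fun p => P p.1 p.2) ↔ P a b := fun a b => by
    simp only [Finset.mem_filter, Finset.mem_product]
    exact ⟨fun h => h.2, fun h => ⟨hP a b h, h⟩⟩
  exact ⟨⟨V, (V ×ˢ V).filter fun p => P p.1 p.2⟩, rfl, hE, fun a b h => hP a b ((hE a b).1 h)⟩

lemma mem_litsOf_of_imp {F : Finset (Finset Lit)} {a b : Lit} (h : imp a b ∈ F) :
    a ∈ litsOf F ∧ b ∈ litsOf F :=
  ⟨mem_litsOf.2 ⟨_, h, _, mem_imp.2 (.inl rfl), rfl⟩,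
    mem_litsOf.2 ⟨_, h, _, mem_imp.2 (.inr rfl), rfl⟩⟩

lemma mem_idg_E {F : Finset (Finset Lit)} {a b : Lit} : (a, b) ∈ (idg F).E ↔ imp a b ∈ F := by
  simp only [idg, Finset.mem_filter, Finset.mem_product]
  exact ⟨fun h => h.2, fun h => ⟨mem_litsOf_of_imp h, h⟩⟩

lemma imp_eq_imp {a b c d : Lit} :
    imp a b = imp c d ↔ (a = c ∧ b = d) ∨ (a = Lit.compl d ∧ b = Lit.compl c) := by
  rw [show imp c d = {Lit.compl c, d} from rfl, imp_eq_pair, compl_invol]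

variable {R : Finset (Finset Lit)} {v a : Lit} {B : Finset Lit}

lemma mem_litsOf_unresolved (hB : B.Nonempty) {x : Lit} :
    x ∈ litsOf (unresolved R v a B) ↔
      x = v ∨ x = Lit.compl v ∨ x ∈ litsOf (resolved R a B) := by
  simp only [litsOf, Finset.mem_product, Finset.mem_univ, and_true, varsOf_unresolved hB,
    Finset.mem_insert]
  constructor
  · rintro (h | h)
    · rcases eq_or_eq_compl h with h | h
      · exact .inl h
      · exact .inr (.inl h)
    · exact .inr (.inr h)
  · rintro (rfl | rfl | h)
    · exact .inl rfl
    · exact .inl (compl_fst _)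
    · exact .inr h

lemma imp_mem_resolved {c d : Lit} : imp c d ∈ resolved R a B ↔
    imp c d ∈ R ∨ (c = Lit.compl a ∧ d ∈ B) ∨ (Lit.compl c ∈ B ∧ d = a) := by
  simp only [mem_resolved, imp_eq_pair, ← compl_eq_iff]
  grind

lemma imp_mem_unresolved {c d : Lit} : imp c d ∈ unresolved R v a B ↔
    (c = Lit.compl v ∧ d = a) ∨ (c = Lit.compl a ∧ d = v) ∨ imp c d ∈ R ∨
      (c = v ∧ d ∈ B) ∨ (Lit.compl c ∈ B ∧ d = Lit.compl v) := by
  simp only [mem_unresolved, imp_eq_pair, ← compl_eq_iff, compl_invol]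
  grind

/-- Undoing a resolution step on a singular variable amounts to two arc splittings, or to two
vertex splittings. -/
lemma IsWDC.idg_unresolved {m : ℕ} (hR : ∀ C ∈ R, ∀ l ∈ C, l.1 ≠ v.1) (ha : a.1 ≠ v.1)
    (hB : ∀ b ∈ B, b.1 ≠ v.1) (hne : B.Nonempty) (hF : MU2 (unresolved R v a B))
    (hd : 2 ≤ deficiency (resolved R a B)) (h : IsWDC m (idg (resolved R a B))) :
    IsWDC m (idg (unresolved R v a B)) := by
  have hF' := mu2_resolved hR ha hB hF
  have hv : ∀ x ∈ litsOf (resolved R a B), x ≠ v ∧ x ≠ Lit.compl v := by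
    intro x hx
    have h1 := notMem_varsOf_resolved hR ha hB
    simp only [litsOf, Finset.mem_product, Finset.mem_univ, and_true] at hx
    exact ⟨by rintro rfl; exact h1 hx, by rintro rfl; exact h1 hx⟩
  have hvv : Lit.compl v ≠ v := compl_ne v
  have haB : a ∉ B := fun h => hF'.singleton_notMem hd a (mem_resolved.2 (.inr ⟨a, h, by simp⟩))
  have hnaB : Lit.compl a ∉ B := fun h => ne_compl_of_mu hR ha hF.1 h rfl
  have hmemG : ∀ c d, (c, d) ∈ (idg (resolved R a B)).E → c ∈ litsOf (resolved R a B) ∧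
      d ∈ litsOf (resolved R a B) := fun c d h => mem_litsOf_of_imp (mem_idg_E.1 h)
  obtain ⟨b₀, hb₀⟩ := hne
  have hab : imp (Lit.compl a) b₀ ∈ resolved R a B := imp_mem_resolved.2 (.inr (.inl ⟨rfl, hb₀⟩))
  have hnaF := (mem_litsOf_of_imp hab).1
  have haF : a ∈ litsOf (resolved R a B) := by simpa using compl_mem hnaF
  have hbF := (mem_litsOf_of_imp hab).2
  have hnbF := compl_mem hbF
  have hmemV : ∀ x, x ∈ (idg (unresolved R v a B)).V ↔
    x = v ∨ x = Lit.compl v ∨ x ∈ litsOf (resolved R a B) :=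
    fun x => mem_litsOf_unresolved ⟨b₀, hb₀⟩
  by_cases hB1 : ∃ b ∈ B, b ≠ b₀
  · obtain ⟨b₁, hb₁, hb01⟩ := hB1
    have haR : ∀ C ∈ R, a ∉ C := by
      intro C hC haC
      have h2 := (hF'.ldeg_bounds haF).2
      refine absurd h2 (not_le.2 (Finset.two_lt_card_iff.2 ⟨{a, b₀}, {a, b₁}, C, ?_⟩))
      simp only [Finset.mem_filter, mem_resolved]
      exact ⟨⟨.inr ⟨b₀, hb₀, rfl⟩, by simp⟩, ⟨.inr ⟨b₁, hb₁, rfl⟩, by simp⟩, ⟨.inl hC, haC⟩,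
        fun h => hb01 (pair_right_inj h).symm,
        fun h => notMem_of_mu hR ha hF.1 hb₀ (h ▸ hC),
        fun h => notMem_of_mu hR ha hF.1 hb₁ (h ▸ hC)⟩
    have hRa : ∀ c d, imp c d ∈ R → c ≠ Lit.compl a ∧ d ≠ a := fun c d hcd =>
      ⟨by rintro rfl; exact haR _ hcd (mem_imp.2 (.inl (by simp))),
        by rintro rfl; exact haR _ hcd (mem_imp.2 (.inr rfl))⟩
    obtain ⟨G, hGV, hGE, hGmem⟩ := FinDigraph.exists_of_arcs (insert v (litsOf (resolved R a B)))
      (fun c d => (c = Lit.compl a ∧ d = v) ∨ (imp c d ∈ R ∨ Lit.compl c ∈ B ∧ d = a) ∨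
        (d ∈ B ∧ c = v)) (by
        intro c d hcd
        have h1 : imp c d ∈ resolved R a B → _ := mem_litsOf_of_imp
        have h2 : imp (Lit.compl a) d ∈ resolved R a B → _ := mem_litsOf_of_imp
        rw [imp_mem_resolved] at h1 h2
        simp only [Finset.mem_insert]
        grind)
    have hG : IsWDC m G := by
      refine h.splitVertex_out (x := Lit.compl a) (v := v) hmemG hnaF ?_ ?_ ?_ ?_
      · rw [mem_idg_E, imp_mem_resolved]
        have := hRa (Lit.compl a) (Lit.compl a)
        have := compl_ne a
        grind
      · exact fun h => (hv v h).1 rfl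
      · intro x
        rw [hGV, Finset.mem_insert]
        rfl
      · intro c d
        rw [hGE]
        simp only [mem_idg_E, imp_mem_resolved, compl_invol]
        have := hRa c d
        have := hRa (Lit.compl a) d
        have : c = Lit.compl a → Lit.compl c = a := by rintro rfl; simp
        grind
    refine hG.splitVertex_in (x := a) (u := Lit.compl v) ?_ ?_ ?_ ?_ ?_ ?_
    · exact hGmem
    · rw [hGV]
      exact Finset.mem_insert_of_mem haF
    · rw [hGE]
      have := hRa a a
      have := hv a haF
      grind
    · rw [hGV, Finset.mem_insert, not_or]
      exact ⟨hvv, fun h => (hv _ h).2 rfl⟩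
    · intro x
      rw [hmemV, hGV, Finset.mem_insert]
      grind
    · intro c d
      rw [mem_idg_E, imp_mem_unresolved]
      simp only [hGE]
      have := hRa c d
      have := hRa c a
      have := hv a haF
      grind
  · have hBb : ∀ b, b ∈ B ↔ b = b₀ := fun b =>
      ⟨fun h => by_contra fun hb => hB1 ⟨b, h, hb⟩, by rintro rfl; exact hb₀⟩
    have hbR : imp (Lit.compl a) b₀ ∉ R := by
      simpa [imp] using notMem_of_mu hR ha hF.1 hb₀
    have hbR' : imp (Lit.compl b₀) a ∉ R := by
      rwa [← imp_compl, compl_invol]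
    obtain ⟨G, hGV, hGE, -⟩ := FinDigraph.exists_of_arcs (insert v (litsOf (resolved R a B)))
      (fun c d => (c = Lit.compl a ∧ d = v) ∨ (c = v ∧ d = b₀) ∨ imp c d ∈ R ∨
        (c = Lit.compl b₀ ∧ d = a)) (by
        intro c d hcd
        have h1 : imp c d ∈ resolved R a B → _ := mem_litsOf_of_imp
        rw [imp_mem_resolved] at h1
        simp only [Finset.mem_insert]
        grind)
    have hG : IsWDC m G := by
      refine h.splitArc (splitArc_iff.2 ⟨Lit.compl a, b₀, v, mem_idg_E.2 hab,
        fun h => (hv v h).1 rfl, fun x => ?_, fun c d => ?_⟩)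
      · rw [hGV, Finset.mem_insert]
        rfl
      · rw [hGE]
        simp only [mem_idg_E, imp_mem_resolved, hBb, compl_eq_iff]
        grind
    refine hG.splitArc (splitArc_iff.2 ⟨Lit.compl b₀, a, Lit.compl v, ?_, ?_, fun x => ?_,
      fun c d => ?_⟩)
    · rw [hGE]
      exact .inr (.inr (.inr ⟨rfl, rfl⟩))
    · rw [hGV, Finset.mem_insert, not_or]
      exact ⟨hvv, fun h => (hv _ h).2 rfl⟩
    · rw [hmemV, hGV, Finset.mem_insert]
      grind
    · simp only [mem_idg_E, imp_mem_unresolved, hGE, hBb, compl_eq_iff]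
      have := hv a haF
      have := hv b₀ hbF
      grind

end ImplicationDigraph

section BaseCase

lemma card_litsOf (F : Finset (Finset Lit)) : (litsOf F).card = 2 * (varsOf F).card := by
  simp [litsOf, Finset.card_product, mul_comm]

lemma MU2.sum_ldeg {F : Finset (Finset Lit)} (hF : MU2 F) (hd : 2 ≤ deficiency F) :
    ∑ y ∈ litsOf F, ldeg F y = 2 * F.card := by
  rw [show (∑ y ∈ litsOf F, ldeg F y) = ∑ C ∈ F, ((litsOf F).filter (fun y => y ∈ C)).card from
    Finset.sum_card_bipartiteAbove_eq_sum_card_bipartiteBelow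
      (fun (y : Lit) (C : Finset Lit) => y ∈ C)]
  rw [Finset.sum_const_nat (m := 2), mul_comm]
  intro C hC
  have h : (litsOf F).filter (fun y => y ∈ C) = C := by
    ext y
    rw [Finset.mem_filter]
    exact ⟨fun h => h.2, fun h => ⟨mem_litsOf.2 ⟨C, hC, y, h, rfl⟩, h⟩⟩
  obtain ⟨l, b, hlb, rfl⟩ := hF.exists_eq_pair hd hC
  rw [h, Finset.card_pair]
  rintro rfl
  exact hlb rfl

lemma MU2.deficiency_eq {F : Finset (Finset Lit)} (hF : MU2 F) (hd : 2 ≤ deficiency F)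
    (hdeg : ∀ y ∈ litsOf F, 2 ≤ ldeg F y) : deficiency F = (varsOf F).card := by
  have h1 := hF.sum_ldeg hd
  rw [Finset.sum_const_nat (m := 2)
    fun y hy => le_antisymm (hF.ldeg_bounds hy).2 (hdeg y hy), card_litsOf] at h1
  unfold deficiency
  omega

lemma MU2.isDoubleCycle {F : Finset (Finset Lit)} (hF : MU2 F) (hd : 2 ≤ deficiency F)
    (hdeg : ∀ y ∈ litsOf F, 2 ≤ ldeg F y) : IsDoubleCycle (2 * (varsOf F).card) (idg F) := by
  obtain ⟨x, p, hp, hC⟩ := hF.exists_double_lasso hd hdeg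
  have hr : 2 ≤ (varsOf F).card := by
    have := hF.deficiency_eq hd hdeg
    omega
  have hcard := card_litsOf F
  have hvars : ∀ j < (varsOf F).card, (p j).1 ∈ varsOf F := fun j hj => hp.mem_varsOf hj
  generalize (varsOf F).card = r at *
  have hlast : p r = Lit.compl (p 0) := hp.last
  set f : ℕ → Lit := fun i => if i < r then p i else Lit.compl (p (i - r)) with hf
  have f1 : ∀ j < r, f j = p j := fun j hj => if_pos hj
  have f2 : ∀ j, f (r + j) = Lit.compl (p j) := fun j => by
    simp [hf]
  have f3 : ∀ j < r, f ((j + 1) % (2 * r)) = p (j + 1) := by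
    intro j hj
    rw [Nat.mod_eq_of_lt (by omega)]
    by_cases h : j + 1 < r
    · exact f1 _ h
    · rw [show j + 1 = r + 0 by omega, f2, ← hlast, add_zero]
  have f4 : ∀ j < r, f ((r + j + 1) % (2 * r)) = Lit.compl (p (j + 1)) := by
    intro j hj
    by_cases h : j + 1 < r
    · rw [Nat.mod_eq_of_lt (by omega), add_assoc, f2]
    · rw [show r + j + 1 = 2 * r by omega, Nat.mod_self, f1 0 (by omega),
        show j + 1 = r by omega, hlast, compl_invol]
  have hsplit : ∀ i < 2 * r, ∃ j < r, i = j ∨ i = r + j := by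
    intro i hi
    by_cases h : i < r
    · exact ⟨i, h, .inl rfl⟩
    · exact ⟨i - r, by omega, .inr (by omega)⟩
  refine ⟨by omega, f, ?_, ?_⟩
  · have hmaps : Set.MapsTo f (Finset.range (2 * r) : Set ℕ) (litsOf F : Set Lit) := by
      intro i hi
      simp only [litsOf, Finset.mem_coe, Finset.mem_product, Finset.mem_univ, and_true]
      obtain ⟨j, hj, rfl | rfl⟩ := hsplit i (by simpa using hi)
      · rw [f1 _ hj]
        exact hvars _ hj
      · rw [f2, compl_fst]
        exact hvars _ hj
    have hinj : Set.InjOn f (Finset.range (2 * r) : Set ℕ) := by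
      intro i hi i' hi' h
      have hne : ∀ j < r, ∀ j' < r, p j ≠ Lit.compl (p j') := by
        intro j hj j' hj' h
        obtain rfl := hp.inj j hj j' hj' (by rw [h, compl_fst])
        exact compl_ne _ h.symm
      obtain ⟨j, hj, rfl | rfl⟩ := hsplit i (by simpa using hi) <;>
      obtain ⟨j', hj', rfl | rfl⟩ := hsplit i' (by simpa using hi')
      · rw [f1 _ hj, f1 _ hj'] at h
        exact hp.inj _ hj _ hj' (by rw [h])
      · rw [f1 _ hj, f2] at h
        exact absurd h (hne _ hj _ hj')
      · rw [f1 _ hj', f2] at h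
        exact absurd h.symm (hne _ hj' _ hj)
      · rw [f2, f2, compl_inj] at h
        rw [hp.inj _ hj _ hj' (by rw [h])]
    refine ⟨hmaps, hinj, Finset.surjOn_of_injOn_of_card_le f hmaps hinj ?_⟩
    exact (hcard.trans (Finset.card_range _).symm).le
  · ext ⟨c, d⟩
    rw [mem_idg_E, hC]
    simp only [stdDoubleCycle, Finset.mem_image, Finset.mem_biUnion, Finset.mem_range,
      Finset.mem_insert, Finset.mem_singleton, Prod.exists, Prod.mk.injEq, imp_eq_imp]
    constructor
    · rintro ⟨a, b, ⟨i, hi, h⟩, rfl, rfl⟩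
      obtain ⟨j, hj, hij⟩ := hsplit i hi
      refine ⟨j, hj, ?_⟩
      rcases h with ⟨ha, hb⟩ | ⟨ha, hb⟩ <;> rw [ha, hb] <;> rcases hij with hij | hij <;> rw [hij]
      · simp [f1 j hj, f3 j hj]
      · simp [f2, f4 j hj]
      · simp [f1 j hj, f3 j hj]
      · simp [f2, f4 j hj]
    · rintro ⟨j, hj, (⟨rfl, rfl⟩ | ⟨rfl, rfl⟩) | (⟨rfl, rfl⟩ | ⟨rfl, rfl⟩)⟩
      · exact ⟨_, _, ⟨j, by omega, .inl ⟨rfl, rfl⟩⟩, f1 j hj, f3 j hj⟩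
      · exact ⟨_, _, ⟨r + j, by omega, .inr ⟨rfl, rfl⟩⟩, f4 j hj, f2 j⟩
      · exact ⟨_, _, ⟨j, by omega, .inr ⟨rfl, rfl⟩⟩, f3 j hj, f1 j hj⟩
      · exact ⟨_, _, ⟨r + j, by omega, .inl ⟨rfl, rfl⟩⟩, f2 j, f4 j hj⟩

end BaseCase

theorem stmt5 (k : ℕ) (hk : 2 ≤ k) (F : Finset (Finset Lit)) (hF : MU2 F)
    (hd : deficiency F = (k : ℤ)) : IsWDC (2 * k) (idg F) := by
  induction hn : (varsOf F).card using Nat.strong_induction_on generalizing F with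
  | _ n ih =>
    subst hn
    have hd2 : 2 ≤ deficiency F := by omega
    by_cases h : ∀ y ∈ litsOf F, 2 ≤ ldeg F y
    · have h1 := hF.deficiency_eq hd2 h
      have h2 := hF.isDoubleCycle hd2 h
      rw [show (varsOf F).card = k by omega] at h2
      exact ⟨idg F, h2, .refl⟩
    · push Not at h
      obtain ⟨v, hv, hlt⟩ := h
      have hv1 : ldeg F v = 1 := by
        have := (hF.ldeg_bounds hv).1
        omega
      obtain ⟨R, a, B, rfl, hR, ha, hB, hne⟩ := hF.exists_unresolved hd2 hv1
      have hδ := deficiency_resolved hR ha hB hne hF.1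
      have hcard := card_varsOf_unresolved hR ha hB hne
      refine IsWDC.idg_unresolved hR ha hB hne hF (by omega) ?_
      exact ih _ (by omega) _ (mu2_resolved hR ha hB hF) (by omega) rfl
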